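/- arXiv:math/0211235 — 4 statements merged into one kernel-verified Lean document; each statement's English description precedes it below -/
import Mathlib

section
/- Let n be a natural number and λ : Fin n → ℝ. There exists a family (χ_R)_{R>0} of smooth, compactly supported functions χ_R : ℂⁿ → ℝ with 0 ≤ χ_R ≤ 1 and χ_R ≡ 1 on the ball {z : |z| ≤ R}, such that for every index j and every smooth f : ℂⁿ → ℂ: (i) if ‖f‖²_{φ₀} < ∞ and ‖∂f/∂z̄_j‖²_{φ₀} < ∞, then lim_{R→∞} ∫_{ℂⁿ} (∂_j^*(∂f/∂z̄_j))(z) · conj(f(z)) · χ_R(z) · e^{−φ₀(z)} dz = ∫_{ℂⁿ} |(∂f/∂z̄_j)(z)|² e^{−φ₀(z)} dz; and (ii) if ‖f‖²_{φ₀} < ∞ and ‖∂_j^* f‖²_{φ₀} < ∞, then lim_{R→∞} ∫_{ℂⁿ} (∂(∂_j^* f)/∂z̄_j)(z) · conj(f(z)) · χ_R(z) · e^{−φ₀(z)} dz = ∫_{ℂⁿ} |(∂_j^* f)(z)|² e^{−φ₀(z)} dz. -/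
open scoped ENNReal NNReal Topology

/-- The Wirtinger derivative `∂f/∂z_j` of `f : ℂⁿ → ℂ` at `a`. -/
noncomputable def wderiv {n : ℕ} (j : Fin n) (f : (Fin n → ℂ) → ℂ) (a : Fin n → ℂ) : ℂ :=
  (1 / 2 : ℂ) *
    (fderiv ℝ f a (Pi.single j 1) - Complex.I * fderiv ℝ f a (Pi.single j Complex.I))

/-- The Wirtinger derivative `∂f/∂z̄_j` of `f : ℂⁿ → ℂ` at `a`. -/
noncomputable def wderivBar {n : ℕ} (j : Fin n) (f : (Fin n → ℂ) → ℂ) (a : Fin n → ℂ) : ℂ :=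
  (1 / 2 : ℂ) *
    (fderiv ℝ f a (Pi.single j 1) + Complex.I * fderiv ℝ f a (Pi.single j Complex.I))

/-- The formal adjoint `∂_j^* g = −∂g/∂z_j + λ_j·conj(z_j)·g` with respect to the
weight `φ₀(z) = ∑ j, λ j |z j|²`. -/
noncomputable def adjOp {n : ℕ} (lam : Fin n → ℝ) (j : Fin n)
    (g : (Fin n → ℂ) → ℂ) (z : Fin n → ℂ) : ℂ :=
  -(wderiv j g z) + (lam j : ℂ) * (starRingEnd ℂ) (z j) * g z

/-- The weight `φ₀(z) = ∑ j, λ j |z j|²`. -/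
noncomputable def phi0 {n : ℕ} (lam : Fin n → ℝ) (z : Fin n → ℂ) : ℝ :=
  ∑ j : Fin n, lam j * ‖z j‖ ^ 2

/-- The weighted `L²`-norm squared `‖f‖²_{φ₀} = ∫ |f|² e^{−φ₀}`, in `[0,∞]`. -/
noncomputable def l2normSq {n : ℕ} (lam : Fin n → ℝ) (f : (Fin n → ℂ) → ℂ) : ℝ≥0∞ :=
  ∫⁻ z : Fin n → ℂ, (‖f z‖₊ : ℝ≥0∞) ^ 2 * ENNReal.ofReal (Real.exp (-(phi0 lam z)))

open MeasureTheory Filter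

lemma ge_wderiv_mul {n : ℕ} (j : Fin n) {f g : (Fin n → ℂ) → ℂ} (hf : Differentiable ℝ f)
    (hg : Differentiable ℝ g) (z : Fin n → ℂ) :
    wderiv j (fun z => f z * g z) z = wderiv j f z * g z + f z * wderiv j g z := by
  unfold wderiv
  rw [show (fun z => f z * g z) = f * g from rfl, fderiv_mul (hf z) (hg z)]
  simp
  ring

lemma ge_wderivBar_mul {n : ℕ} (j : Fin n) {f g : (Fin n → ℂ) → ℂ} (hf : Differentiable ℝ f)
    (hg : Differentiable ℝ g) (z : Fin n → ℂ) :
    wderivBar j (fun z => f z * g z) z = wderivBar j f z * g z + f z * wderivBar j g z := by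
  unfold wderivBar
  rw [show (fun z => f z * g z) = f * g from rfl, fderiv_mul (hf z) (hg z)]
  simp
  ring

lemma ge_fderiv_conj {n : ℕ} {f : (Fin n → ℂ) → ℂ} (hf : Differentiable ℝ f)
    (z v : Fin n → ℂ) :
    fderiv ℝ (fun z => (starRingEnd ℂ) (f z)) z v = (starRingEnd ℂ) (fderiv ℝ f z v) := by
  have h := (Complex.conjCLE.toContinuousLinearMap.hasFDerivAt (x := f z)).comp z
    (hf z).hasFDerivAt
  have h2 : HasFDerivAt (fun z => (starRingEnd ℂ) (f z)) _ z := h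
  rw [h2.fderiv]
  simp

lemma ge_wderiv_conj {n : ℕ} (j : Fin n) {f : (Fin n → ℂ) → ℂ} (hf : Differentiable ℝ f)
    (z : Fin n → ℂ) :
    wderiv j (fun z => (starRingEnd ℂ) (f z)) z = (starRingEnd ℂ) (wderivBar j f z) := by
  unfold wderiv wderivBar
  rw [ge_fderiv_conj hf, ge_fderiv_conj hf]
  have h2 : (starRingEnd ℂ) 2 = 2 := Complex.conj_ofNat 2
  simp [h2]
  ring

lemma ge_wderivBar_conj {n : ℕ} (j : Fin n) {f : (Fin n → ℂ) → ℂ} (hf : Differentiable ℝ f)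
    (z : Fin n → ℂ) :
    wderivBar j (fun z => (starRingEnd ℂ) (f z)) z = (starRingEnd ℂ) (wderiv j f z) := by
  unfold wderiv wderivBar
  rw [ge_fderiv_conj hf, ge_fderiv_conj hf]
  have h2 : (starRingEnd ℂ) 2 = 2 := Complex.conj_ofNat 2
  simp [h2]

lemma ge_phi0_contDiff {n : ℕ} (lam : Fin n → ℝ) : ContDiff ℝ (⊤ : ℕ∞) (phi0 lam) := by
  unfold phi0
  refine ContDiff.sum fun i _ => contDiff_const.mul ?_
  exact (contDiff_apply ℝ ℂ i).norm_sq ℝ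

lemma ge_phi0_fderiv {n : ℕ} (lam : Fin n → ℝ) (j : Fin n) (z : Fin n → ℂ) (c : ℂ) :
    fderiv ℝ (phi0 lam) z (Pi.single j c) = lam j * (2 * inner ℝ (z j) c) := by
  have h : HasFDerivAt (phi0 lam) (∑ i : Fin n, lam i •
      (2 • (innerSL ℝ (z i)).comp (ContinuousLinearMap.proj (R := ℝ) (φ := fun _ : Fin n => ℂ) i))) z := by
    unfold phi0
    refine HasFDerivAt.fun_sum fun i _ => HasFDerivAt.const_mul ?_ _
    exact (ContinuousLinearMap.hasFDerivAt
      (ContinuousLinearMap.proj (R := ℝ) (φ := fun _ : Fin n => ℂ) i)).norm_sq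
  rw [h.fderiv, ContinuousLinearMap.sum_apply, Finset.sum_eq_single j]
  · simp
    left
    ring
  · intro b _ hb
    simp [Pi.single_eq_of_ne hb]
  · simp

/-- the weight as a complex function -/
noncomputable def geW {n : ℕ} (lam : Fin n → ℝ) (z : Fin n → ℂ) : ℂ :=
  Complex.exp (-(phi0 lam z : ℂ))

lemma geW_contDiff {n : ℕ} (lam : Fin n → ℝ) : ContDiff ℝ (⊤ : ℕ∞) (geW lam) := by
  unfold geW
  exact ((Complex.ofRealCLM.contDiff.comp (ge_phi0_contDiff lam)).neg).cexp

lemma geW_eq {n : ℕ} (lam : Fin n → ℝ) (z : Fin n → ℂ) :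
    geW lam z = ((Real.exp (-(phi0 lam z)) : ℝ) : ℂ) := by
  unfold geW; push_cast; rfl

lemma geW_fderiv {n : ℕ} (lam : Fin n → ℝ) (j : Fin n) (z : Fin n → ℂ) (c : ℂ) :
    fderiv ℝ (geW lam) z (Pi.single j c) =
      -((lam j * (2 * inner ℝ (z j) c) : ℝ) : ℂ) * geW lam z := by
  have h1 : HasFDerivAt (phi0 lam) (fderiv ℝ (phi0 lam) z) z :=
    ((ge_phi0_contDiff lam).differentiable (by simp) z).hasFDerivAt
  have h2 := (Complex.ofRealCLM.hasFDerivAt (x := phi0 lam z)).comp z h1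
  have h3 : HasFDerivAt (geW lam) _ z := h2.neg.cexp
  rw [h3.fderiv]
  simp only [ContinuousLinearMap.smul_apply, ContinuousLinearMap.neg_apply,
    ContinuousLinearMap.comp_apply, ge_phi0_fderiv, geW]
  simp
  ring

lemma geW_wderiv {n : ℕ} (lam : Fin n → ℝ) (j : Fin n) (z : Fin n → ℂ) :
    wderiv j (geW lam) z = -((lam j : ℂ) * (starRingEnd ℂ) (z j)) * geW lam z := by
  unfold wderiv
  rw [geW_fderiv, geW_fderiv]
  have : (starRingEnd ℂ) (z j) = (((z j).re : ℝ) : ℂ) - ((z j).im : ℝ) * Complex.I := by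
    apply Complex.ext <;> simp
  rw [this]
  simp [Complex.inner]
  ring

lemma geW_wderivBar {n : ℕ} (lam : Fin n → ℝ) (j : Fin n) (z : Fin n → ℂ) :
    wderivBar j (geW lam) z = -((lam j : ℂ) * z j) * geW lam z := by
  unfold wderivBar
  rw [geW_fderiv, geW_fderiv]
  have : z j = (((z j).re : ℝ) : ℂ) + ((z j).im : ℝ) * Complex.I := by
    apply Complex.ext <;> simp
  simp [Complex.inner]
  linear_combination (lam j : ℂ) * geW lam z * this

lemma ge_fderiv_contDiff {n : ℕ} {f : (Fin n → ℂ) → ℂ} (hf : ContDiff ℝ (⊤ : ℕ∞) f)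
    (v : Fin n → ℂ) : ContDiff ℝ (⊤ : ℕ∞) (fun z => fderiv ℝ f z v) :=
  (hf.fderiv_right (m := (⊤ : ℕ∞)) (by simp)).clm_apply contDiff_const

lemma ge_wderiv_contDiff {n : ℕ} (j : Fin n) {f : (Fin n → ℂ) → ℂ}
    (hf : ContDiff ℝ (⊤ : ℕ∞) f) : ContDiff ℝ (⊤ : ℕ∞) (fun z => wderiv j f z) := by
  unfold wderiv
  exact contDiff_const.mul ((ge_fderiv_contDiff hf _).sub
    (contDiff_const.mul (ge_fderiv_contDiff hf _)))

lemma ge_wderivBar_contDiff {n : ℕ} (j : Fin n) {f : (Fin n → ℂ) → ℂ}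
    (hf : ContDiff ℝ (⊤ : ℕ∞) f) : ContDiff ℝ (⊤ : ℕ∞) (fun z => wderivBar j f z) := by
  unfold wderivBar
  exact contDiff_const.mul ((ge_fderiv_contDiff hf _).add
    (contDiff_const.mul (ge_fderiv_contDiff hf _)))

lemma ge_conj_contDiff {n : ℕ} {f : (Fin n → ℂ) → ℂ}
    (hf : ContDiff ℝ (⊤ : ℕ∞) f) : ContDiff ℝ (⊤ : ℕ∞) (fun z => (starRingEnd ℂ) (f z)) :=
  Complex.conjCLE.toContinuousLinearMap.contDiff.comp hf

lemma ge_adjOp_contDiff {n : ℕ} (lam : Fin n → ℝ) (j : Fin n) {f : (Fin n → ℂ) → ℂ}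
    (hf : ContDiff ℝ (⊤ : ℕ∞) f) : ContDiff ℝ (⊤ : ℕ∞) (fun z => adjOp lam j f z) := by
  unfold adjOp
  exact (ge_wderiv_contDiff j hf).neg.add
    ((contDiff_const.mul (ge_conj_contDiff (contDiff_apply ℝ ℂ j))).mul hf)

lemma ge_integral_fderiv {n : ℕ} {F : (Fin n → ℂ) → ℂ} (hF : ContDiff ℝ (⊤ : ℕ∞) F)
    (hc : HasCompactSupport F) (v : Fin n → ℂ) :
    Integrable (fun z => fderiv ℝ F z v) ∧ ∫ z, fderiv ℝ F z v = 0 := by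
  have hi : Integrable (fun z => fderiv ℝ F z v) :=
    (ge_fderiv_contDiff hF v).continuous.integrable_of_hasCompactSupport (hc.fderiv_apply ℝ v)
  refine ⟨hi, ?_⟩
  have h := integral_mul_fderiv_eq_neg_fderiv_mul_of_integrable (μ := (volume : Measure (Fin n → ℂ)))
    (f := fun _ => (1 : ℂ)) (g := F) (v := v) (by simp) (by simpa using hi)
    (by simpa using hF.continuous.integrable_of_hasCompactSupport hc)
    (fun _ _ => differentiableAt_const _) (fun x _ => hF.differentiable (by simp) x)
  simpa using h

lemma ge_integral_wderiv {n : ℕ} (j : Fin n) {F : (Fin n → ℂ) → ℂ}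
    (hF : ContDiff ℝ (⊤ : ℕ∞) F) (hc : HasCompactSupport F) :
    Integrable (fun z => wderiv j F z) ∧ ∫ z, wderiv j F z = 0 := by
  obtain ⟨h1, h2⟩ := ge_integral_fderiv hF hc (Pi.single j 1)
  obtain ⟨h3, h4⟩ := ge_integral_fderiv hF hc (Pi.single j Complex.I)
  unfold wderiv
  refine ⟨(h1.sub (h3.const_mul _)).const_mul _, ?_⟩
  rw [integral_const_mul, integral_sub h1 (h3.const_mul _), integral_const_mul, h2, h4]
  simp

lemma ge_integral_wderivBar {n : ℕ} (j : Fin n) {F : (Fin n → ℂ) → ℂ}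
    (hF : ContDiff ℝ (⊤ : ℕ∞) F) (hc : HasCompactSupport F) :
    Integrable (fun z => wderivBar j F z) ∧ ∫ z, wderivBar j F z = 0 := by
  obtain ⟨h1, h2⟩ := ge_integral_fderiv hF hc (Pi.single j 1)
  obtain ⟨h3, h4⟩ := ge_integral_fderiv hF hc (Pi.single j Complex.I)
  unfold wderivBar
  refine ⟨(h1.add (h3.const_mul _)).const_mul _, ?_⟩
  rw [integral_const_mul, integral_add h1 (h3.const_mul _), integral_const_mul, h2, h4]
  simp

lemma ge_integrable_of_l2 {n : ℕ} (lam : Fin n → ℝ) {f : (Fin n → ℂ) → ℂ}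
    (hf : Continuous f) (h : l2normSq lam f < ⊤) :
    Integrable (fun z => ‖f z‖ ^ 2 * Real.exp (-(phi0 lam z))) := by
  have hp := (ge_phi0_contDiff lam).continuous
  refine ⟨by fun_prop, ?_⟩
  rw [hasFiniteIntegral_iff_ofReal (Eventually.of_forall fun z => by positivity)]
  refine lt_of_le_of_lt (le_of_eq ?_) h
  unfold l2normSq
  refine lintegral_congr fun z => ?_
  rw [ENNReal.ofReal_mul (by positivity), ENNReal.ofReal_pow (norm_nonneg _), ofReal_norm]
  rfl

/-- the limit lemma -/
lemma ge_limit {n : ℕ} (lam : Fin n → ℝ) {g f : (Fin n → ℂ) → ℂ}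
    (hg : Continuous g) (hf : Continuous f)
    (hgi : l2normSq lam g < ⊤) (hfi : l2normSq lam f < ⊤)
    (χ : ℝ → (Fin n → ℂ) → ℝ) (d : ℝ → (Fin n → ℂ) → ℂ) (C : ℝ)
    (hχc : ∀ R, 0 < R → Continuous (χ R)) (hdc : ∀ R, 0 < R → Continuous (d R))
    (hχ : ∀ R, 0 < R → ∀ z, 0 ≤ χ R z ∧ χ R z ≤ 1)
    (hχ1 : ∀ R, 0 < R → ∀ z : Fin n → ℂ, ‖z‖ ≤ R → χ R z = 1)
    (hd : ∀ R, 0 < R → ∀ z, ‖d R z‖ ≤ C / R) :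
    Tendsto (fun R : ℝ => ∫ z, (g z * (starRingEnd ℂ) (g z) * (χ R z : ℂ) * geW lam z
      + g z * (starRingEnd ℂ) (f z) * d R z * geW lam z)) atTop
      (𝓝 ((∫ z, ‖g z‖ ^ 2 * Real.exp (-(phi0 lam z)) : ℝ) : ℂ)) := by
  have hC : 0 ≤ C := by
    have := (norm_nonneg _).trans (hd 1 one_pos 0)
    simpa using this
  have Ig := ge_integrable_of_l2 lam hg hgi
  have If := ge_integrable_of_l2 lam hf hfi
  have hW := (geW_contDiff lam).continuous
  have hWn : ∀ z, ‖geW lam z‖ = Real.exp (-(phi0 lam z)) := fun z => by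
    rw [geW_eq, Complex.norm_real, Real.norm_of_nonneg (Real.exp_pos _).le]
  rw [← integral_complex_ofReal]
  refine tendsto_integral_filter_of_dominated_convergence
    (fun z => ‖g z‖ ^ 2 * Real.exp (-(phi0 lam z)) + C * (‖g z‖ ^ 2 * Real.exp (-(phi0 lam z)) +
      ‖f z‖ ^ 2 * Real.exp (-(phi0 lam z)))) ?_ ?_ (Ig.add ((Ig.add If).const_mul C)) ?_
  · filter_upwards [eventually_gt_atTop 0] with R hR
    have h1 := hχc R hR
    have h2 := hdc R hR
    have h3 : Continuous fun z => (starRingEnd ℂ) (g z) := Complex.continuous_conj.comp hg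
    have h4 : Continuous fun z => (starRingEnd ℂ) (f z) := Complex.continuous_conj.comp hf
    have h5 : Continuous fun z => (χ R z : ℂ) := Complex.continuous_ofReal.comp h1
    exact ((((hg.mul h3).mul h5).mul hW).add (((hg.mul h4).mul h2).mul hW)).aestronglyMeasurable
  · filter_upwards [eventually_ge_atTop 1] with R hR
    refine Eventually.of_forall fun z => ?_
    have hR0 : 0 < R := by linarith
    have hd' : ‖d R z‖ ≤ C := (hd R hR0 z).trans (div_le_self hC hR)
    obtain ⟨c0, c1⟩ := hχ R hR0 z
    have he := (Real.exp_pos (-(phi0 lam z))).le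
    refine (norm_add_le _ _).trans (add_le_add ?_ ?_)
    · simp only [norm_mul, RCLike.norm_conj, hWn, Complex.norm_real, Real.norm_of_nonneg c0]
      have : ‖g z‖ * ‖g z‖ * χ R z ≤ ‖g z‖ ^ 2 := by
        rw [← sq]; exact mul_le_of_le_one_right (by positivity) c1
      gcongr
    · simp only [norm_mul, RCLike.norm_conj, hWn]
      have h1 : ‖g z‖ * ‖f z‖ ≤ ‖g z‖ ^ 2 + ‖f z‖ ^ 2 := by
        nlinarith [sq_nonneg (‖g z‖ - ‖f z‖), sq_nonneg ‖g z‖, sq_nonneg ‖f z‖]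
      calc ‖g z‖ * ‖f z‖ * ‖d R z‖ * Real.exp (-(phi0 lam z))
          ≤ (‖g z‖ ^ 2 + ‖f z‖ ^ 2) * C * Real.exp (-(phi0 lam z)) := by gcongr
        _ = _ := by ring
  · refine Eventually.of_forall fun z => ?_
    have hd0 : Tendsto (fun R => d R z) atTop (𝓝 0) := by
      refine squeeze_zero_norm' ?_ ((tendsto_const_nhds (x := C)).div_atTop tendsto_id)
      filter_upwards [eventually_gt_atTop 0] with R hR
      exact hd R hR z
    have hc1 : Tendsto (fun R => (χ R z : ℂ)) atTop (𝓝 1) := by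
      refine tendsto_const_nhds.congr' ?_
      filter_upwards [eventually_gt_atTop 0, eventually_ge_atTop ‖z‖] with R hR hz
      rw [hχ1 R hR z hz]; simp
    have h := ((hc1.const_mul (g z * (starRingEnd ℂ) (g z))).mul_const (geW lam z)).add
      ((hd0.const_mul (g z * (starRingEnd ℂ) (f z))).mul_const (geW lam z))
    convert h using 2
    rw [geW_eq, Complex.mul_conj, Complex.normSq_eq_norm_sq]
    push_cast
    ring

/-- the cutoffs -/
lemma ge_cutoff (n : ℕ) : ∃ (χ : ℝ → (Fin n → ℂ) → ℝ) (C : ℝ), ∀ R : ℝ, 0 < R →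
    ContDiff ℝ (⊤ : ℕ∞) (χ R) ∧ HasCompactSupport (χ R) ∧
        (∀ z, 0 ≤ χ R z ∧ χ R z ≤ 1) ∧ (∀ z : Fin n → ℂ, ‖z‖ ≤ R → χ R z = 1) ∧
        ∀ z, ‖fderiv ℝ (χ R) z‖ ≤ C / R := by
  let b : ContDiffBump (0 : Fin n → ℂ) := ⟨1, 2, one_pos, one_lt_two⟩
  have hb : ContDiff ℝ (⊤ : ℕ∞) b := b.contDiff
  obtain ⟨C, hC⟩ := (b.hasCompactSupport.fderiv ℝ).exists_bound_of_continuous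
    (hb.continuous_fderiv (by simp))
  refine ⟨fun R z => b (R⁻¹ • z), C, fun R hR => ⟨hb.comp (contDiff_const_smul _), ?_, 
    fun z => ⟨b.nonneg, b.le_one⟩, fun z hz => ?_, fun z => ?_⟩⟩
  · exact b.hasCompactSupport.comp_smul (inv_ne_zero hR.ne')
  · apply b.one_of_mem_closedBall
    simp only [mem_closedBall_zero_iff, norm_smul, norm_inv, Real.norm_of_nonneg hR.le, b]
    rw [inv_mul_le_iff₀ hR]; simpa using hz
  · rw [fderiv_comp_smul, norm_smul, norm_inv, Real.norm_of_nonneg hR.le, inv_mul_eq_div]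
    gcongr
    exact hC _

lemma ge_wd_bound {n : ℕ} (j : Fin n) {χ : (Fin n → ℂ) → ℝ} (hχ : Differentiable ℝ χ)
    {K : ℝ} (z : Fin n → ℂ) (h : ‖fderiv ℝ χ z‖ ≤ K) :
    ‖wderiv j (fun z => (χ z : ℂ)) z‖ ≤ K ∧ ‖wderivBar j (fun z => (χ z : ℂ)) z‖ ≤ K := by
  have hv : ∀ c : ℂ, ‖c‖ = 1 → ‖fderiv ℝ (fun z => (χ z : ℂ)) z (Pi.single j c)‖ ≤ K := by
    intro c hc
    have h2 : HasFDerivAt (fun z => (χ z : ℂ)) _ z :=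
      (Complex.ofRealCLM.hasFDerivAt (x := χ z)).comp z (hχ z).hasFDerivAt
    rw [h2.fderiv]
    simp only [ContinuousLinearMap.comp_apply, Complex.ofRealCLM_apply, Complex.norm_real]
    have := (fderiv ℝ χ z).le_of_opNorm_le h (Pi.single j c)
    rwa [Pi.norm_single, hc, mul_one] at this
  have h1 := hv 1 (by simp)
  have h2 := hv Complex.I (by simp)
  unfold wderiv wderivBar
  constructor
  · rw [norm_mul]
    have := norm_sub_le (fderiv ℝ (fun z => (χ z : ℂ)) z (Pi.single j 1))
      (Complex.I * fderiv ℝ (fun z => (χ z : ℂ)) z (Pi.single j Complex.I))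
    rw [norm_mul, Complex.norm_I, one_mul] at this
    norm_num
    linarith
  · rw [norm_mul]
    have := norm_add_le (fderiv ℝ (fun z => (χ z : ℂ)) z (Pi.single j 1))
      (Complex.I * fderiv ℝ (fun z => (χ z : ℂ)) z (Pi.single j Complex.I))
    rw [norm_mul, Complex.norm_I, one_mul] at this
    norm_num
    linarith

lemma ge_hcs {n : ℕ} {χ : (Fin n → ℂ) → ℝ} (hc : HasCompactSupport χ) :
    HasCompactSupport (fun z => (χ z : ℂ)) :=
  hc.comp_left (g := fun x : ℝ => (x : ℂ)) (by simp)

lemma ge_ibp1 {n : ℕ} (lam : Fin n → ℝ) (j : Fin n) {f g : (Fin n → ℂ) → ℂ}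
    (hf : ContDiff ℝ (⊤ : ℕ∞) f) (hg : ContDiff ℝ (⊤ : ℕ∞) g)
    {χ : (Fin n → ℂ) → ℝ} (hχ : ContDiff ℝ (⊤ : ℕ∞) χ) (hc : HasCompactSupport χ) :
    ∫ z, adjOp lam j g z * (starRingEnd ℂ) (f z) * (χ z : ℂ) * geW lam z =
    ∫ z, (g z * (starRingEnd ℂ) (wderivBar j f z) * (χ z : ℂ) * geW lam z
      + g z * (starRingEnd ℂ) (f z) * wderiv j (fun z => (χ z : ℂ)) z * geW lam z) := by
  have hX : ContDiff ℝ (⊤ : ℕ∞) (fun z => (χ z : ℂ)) := Complex.ofRealCLM.contDiff.comp hχ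
  have hcf := ge_conj_contDiff hf
  have hW := geW_contDiff lam
  have hXc := ge_hcs hc
  have h12 := hg.mul hcf
  have h123 := h12.mul hX
  have h1234 := h123.mul hW
  have hFc : HasCompactSupport fun z => g z * (starRingEnd ℂ) (f z) * (χ z : ℂ) * geW lam z :=
    (hXc.mul_left (f := fun z => g z * (starRingEnd ℂ) (f z))).mul_right
  obtain ⟨hi, h0⟩ := ge_integral_wderiv j h1234 hFc
  have hA : Integrable fun z =>
      adjOp lam j g z * (starRingEnd ℂ) (f z) * (χ z : ℂ) * geW lam z := by
    refine Continuous.integrable_of_hasCompactSupport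
      ((((ge_adjOp_contDiff lam j hg).mul hcf).mul hX).mul hW).continuous ?_
    exact (hXc.mul_left (f := fun z => adjOp lam j g z * (starRingEnd ℂ) (f z))).mul_right
  rw [← add_zero (∫ z, adjOp lam j g z * _ * _ * _), ← h0, ← integral_add hA hi]
  refine integral_congr_ae (Eventually.of_forall fun z => ?_)
  have t : (⊤ : ℕ∞) ≠ 0 := by simp
  have t' : ((⊤ : ℕ∞) : WithTop ℕ∞) ≠ 0 := by simp
  simp only
  rw [ge_wderiv_mul j (h123.differentiable t') (hW.differentiable t'),
    ge_wderiv_mul j (h12.differentiable t') (hX.differentiable t'),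
    ge_wderiv_mul j (hg.differentiable t') (hcf.differentiable t'),
    ge_wderiv_conj j (hf.differentiable t'), geW_wderiv]
  unfold adjOp
  ring

lemma ge_ibp2 {n : ℕ} (lam : Fin n → ℝ) (j : Fin n) {f g : (Fin n → ℂ) → ℂ}
    (hf : ContDiff ℝ (⊤ : ℕ∞) f) (hg : ContDiff ℝ (⊤ : ℕ∞) g)
    {χ : (Fin n → ℂ) → ℝ} (hχ : ContDiff ℝ (⊤ : ℕ∞) χ) (hc : HasCompactSupport χ) :
    ∫ z, wderivBar j g z * (starRingEnd ℂ) (f z) * (χ z : ℂ) * geW lam z =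
    ∫ z, (g z * (starRingEnd ℂ) (adjOp lam j f z) * (χ z : ℂ) * geW lam z
      + g z * (starRingEnd ℂ) (f z) * (-wderivBar j (fun z => (χ z : ℂ)) z) * geW lam z) := by
  have hX : ContDiff ℝ (⊤ : ℕ∞) (fun z => (χ z : ℂ)) := Complex.ofRealCLM.contDiff.comp hχ
  have hcf := ge_conj_contDiff hf
  have hW := geW_contDiff lam
  have hXc := ge_hcs hc
  have h12 := hg.mul hcf
  have h123 := h12.mul hX
  have h1234 := h123.mul hW
  have hFc : HasCompactSupport fun z => g z * (starRingEnd ℂ) (f z) * (χ z : ℂ) * geW lam z :=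
    (hXc.mul_left (f := fun z => g z * (starRingEnd ℂ) (f z))).mul_right
  obtain ⟨hi, h0⟩ := ge_integral_wderivBar j h1234 hFc
  have hA : Integrable fun z =>
      wderivBar j g z * (starRingEnd ℂ) (f z) * (χ z : ℂ) * geW lam z := by
    refine Continuous.integrable_of_hasCompactSupport
      ((((ge_wderivBar_contDiff j hg).mul hcf).mul hX).mul hW).continuous ?_
    exact (hXc.mul_left (f := fun z => wderivBar j g z * (starRingEnd ℂ) (f z))).mul_right
  rw [← sub_zero (∫ z, wderivBar j g z * _ * _ * _), ← h0, ← integral_sub hA hi]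
  refine integral_congr_ae (Eventually.of_forall fun z => ?_)
  have t' : ((⊤ : ℕ∞) : WithTop ℕ∞) ≠ 0 := by simp
  simp only
  rw [ge_wderivBar_mul j (h123.differentiable t') (hW.differentiable t'),
    ge_wderivBar_mul j (h12.differentiable t') (hX.differentiable t'),
    ge_wderivBar_mul j (hg.differentiable t') (hcf.differentiable t'),
    ge_wderivBar_conj j (hf.differentiable t'), geW_wderivBar]
  unfold adjOp
  simp only [map_add, map_neg, map_mul, Complex.conj_conj, Complex.conj_ofReal]
  ring

/-- The Gromov-trick exhaustion sequence: there are smooth compactly supported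
cutoffs `χ_R`, with `0 ≤ χ_R ≤ 1` and `χ_R ≡ 1` on the ball of radius `R`, such
that integration by parts against `χ_R` in the weighted inner product recovers
`‖∂f/∂z̄_j‖²_{φ₀}` resp. `‖∂_j^* f‖²_{φ₀}` in the limit `R → ∞`. -/
theorem gromov_exhaustion (n : ℕ) (lam : Fin n → ℝ) :
    ∃ χ : ℝ → (Fin n → ℂ) → ℝ,
      (∀ R : ℝ, 0 < R →
        ContDiff ℝ (⊤ : ℕ∞) (χ R) ∧ HasCompactSupport (χ R) ∧
        (∀ z, 0 ≤ χ R z ∧ χ R z ≤ 1) ∧ (∀ z : Fin n → ℂ, ‖z‖ ≤ R → χ R z = 1)) ∧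
      ∀ (j : Fin n) (f : (Fin n → ℂ) → ℂ), ContDiff ℝ (⊤ : ℕ∞) f →
        ((l2normSq lam f < ⊤ → l2normSq lam (fun z => wderivBar j f z) < ⊤ →
          Filter.Tendsto
            (fun R : ℝ => ∫ z : Fin n → ℂ,
              adjOp lam j (fun w => wderivBar j f w) z * (starRingEnd ℂ) (f z) *
                (χ R z : ℂ) * Complex.exp (-(phi0 lam z : ℂ)))
            Filter.atTop
            (𝓝 ((∫ z : Fin n → ℂ,
              ‖wderivBar j f z‖ ^ 2 * Real.exp (-(phi0 lam z)) : ℝ) : ℂ))) ∧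
        (l2normSq lam f < ⊤ → l2normSq lam (fun z => adjOp lam j f z) < ⊤ →
          Filter.Tendsto
            (fun R : ℝ => ∫ z : Fin n → ℂ,
              wderivBar j (fun w => adjOp lam j f w) z * (starRingEnd ℂ) (f z) *
                (χ R z : ℂ) * Complex.exp (-(phi0 lam z : ℂ)))
            Filter.atTop
            (𝓝 ((∫ z : Fin n → ℂ,
              ‖adjOp lam j f z‖ ^ 2 * Real.exp (-(phi0 lam z)) : ℝ) : ℂ)))) := by
  obtain ⟨χ, C, h⟩ := ge_cutoff n
  have hX : ∀ R, 0 < R → ContDiff ℝ (⊤ : ℕ∞) (fun z => (χ R z : ℂ)) :=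
    fun R hR => Complex.ofRealCLM.contDiff.comp (h R hR).1
  refine ⟨χ, fun R hR => ?_, fun j f hf => ⟨fun h1 h2 => ?_, fun h1 h2 => ?_⟩⟩
  · obtain ⟨a, b, c, d, _⟩ := h R hR
    exact ⟨a, b, c, d⟩
  · have hg := ge_wderivBar_contDiff j hf
    refine (ge_limit lam hg.continuous hf.continuous h2 h1 χ
      (fun R => wderiv j (fun z => (χ R z : ℂ))) C (fun R hR => (h R hR).1.continuous)
      (fun R hR => (ge_wderiv_contDiff j (hX R hR)).continuous) (fun R hR => (h R hR).2.2.1)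
      (fun R hR => (h R hR).2.2.2.1) (fun R hR z => (ge_wd_bound j
        ((h R hR).1.differentiable (by simp)) z ((h R hR).2.2.2.2 z)).1)).congr' ?_
    filter_upwards [eventually_gt_atTop 0] with R hR
    exact (ge_ibp1 lam j hf hg (h R hR).1 (h R hR).2.1).symm
  · have hg := ge_adjOp_contDiff lam j hf
    refine (ge_limit lam hg.continuous hf.continuous h2 h1 χ
      (fun R z => -wderivBar j (fun z => (χ R z : ℂ)) z) C (fun R hR => (h R hR).1.continuous)
      (fun R hR => (ge_wderivBar_contDiff j (hX R hR)).neg.continuous) (fun R hR => (h R hR).2.2.1)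
      (fun R hR => (h R hR).2.2.2.1) (fun R hR z => (norm_neg _).trans_le (ge_wd_bound j
        ((h R hR).1.differentiable (by simp)) z ((h R hR).2.2.2.2 z)).2)).congr' ?_
    filter_upwards [eventually_gt_atTop 0] with R hR
    exact (ge_ibp2 lam j hf hg (h R hR).1 (h R hR).2.1).symm
end

section
/- Let n be a natural number, λ : Fin n → ℝ, and I ⊆ Fin n. Let f : ℂⁿ → ℂ be smooth with ‖f‖²_{φ₀} < ∞, with ‖∂f/∂z̄_j‖²_{φ₀} < ∞ for every j ∉ I, and with ‖∂_j^* f‖²_{φ₀} < ∞ for every j ∈ I. If Σ_{j∈I} ∂(∂_j^* f)/∂z̄_j + Σ_{j∉I} ∂_j^*(∂f/∂z̄_j) = 0 pointwise on ℂⁿ, then ∂_j^* f = 0 on ℂⁿ for every j ∈ I and ∂f/∂z̄_j = 0 on ℂⁿ for every j ∉ I. -/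
open scoped ENNReal NNReal

section
variable {n : ℕ}
open MeasureTheory
open scoped ContDiff

lemma wderiv_mul (j : Fin n) (u v : (Fin n → ℂ) → ℂ) (z) (hu : DifferentiableAt ℝ u z)
    (hv : DifferentiableAt ℝ v z) :
    wderiv j (fun z => u z * v z) z = wderiv j u z * v z + u z * wderiv j v z := by
  simp only [wderiv, fderiv_fun_mul hu hv]
  simp
  ring

lemma wderivBar_mul (j : Fin n) (u v : (Fin n → ℂ) → ℂ) (z) (hu : DifferentiableAt ℝ u z)
    (hv : DifferentiableAt ℝ v z) :
    wderivBar j (fun z => u z * v z) z = wderivBar j u z * v z + u z * wderivBar j v z := by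
  simp only [wderivBar, fderiv_fun_mul hu hv]
  simp
  ring

lemma fderiv_conj' (u : (Fin n → ℂ) → ℂ) (z v) (hu : DifferentiableAt ℝ u z) :
    fderiv ℝ (fun z => (starRingEnd ℂ) (u z)) z v = (starRingEnd ℂ) (fderiv ℝ u z v) := by
  have h := (Complex.conjCLE.hasFDerivAt (x := u z)).comp z hu.hasFDerivAt
  have h2 : HasFDerivAt (fun z => (starRingEnd ℂ) (u z)) _ z := h
  rw [h2.fderiv]; simp

lemma wderiv_conj (j : Fin n) (u : (Fin n → ℂ) → ℂ) (z) (hu : DifferentiableAt ℝ u z) :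
    wderiv j (fun z => (starRingEnd ℂ) (u z)) z = (starRingEnd ℂ) (wderivBar j u z) := by
  simp only [wderiv, wderivBar, fderiv_conj' u z _ hu]
  simp [map_ofNat (starRingEnd ℂ) 2]; ring

lemma wderivBar_conj (j : Fin n) (u : (Fin n → ℂ) → ℂ) (z) (hu : DifferentiableAt ℝ u z) :
    wderivBar j (fun z => (starRingEnd ℂ) (u z)) z = (starRingEnd ℂ) (wderiv j u z) := by
  simp only [wderiv, wderivBar, fderiv_conj' u z _ hu]
  simp [map_ofNat (starRingEnd ℂ) 2]

/-- complex-valued weight -/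
noncomputable def wt (lam : Fin n → ℝ) (z : Fin n → ℂ) : ℂ := (Real.exp (-(phi0 lam z)) : ℝ)

lemma hasFDerivAt_phi0 (lam : Fin n → ℝ) (z : Fin n → ℂ) :
    HasFDerivAt (phi0 lam) (∑ i, lam i • (2 • (innerSL ℝ (z i)).comp
      (ContinuousLinearMap.proj (R := ℝ) (φ := fun _ : Fin n => ℂ) i))) z := by
  unfold phi0
  refine HasFDerivAt.fun_sum fun i _ => HasFDerivAt.const_mul ?_ _
  exact (hasStrictFDerivAt_norm_sq (z i)).hasFDerivAt.comp z
    (ContinuousLinearMap.proj (R := ℝ) (φ := fun _ : Fin n => ℂ) i).hasFDerivAt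

lemma contDiff_phi0 (lam : Fin n → ℝ) : ContDiff ℝ ∞ (phi0 lam) := by
  unfold phi0
  refine ContDiff.sum fun i _ => contDiff_const.mul (ContDiff.norm_sq ℝ (contDiff_apply ℝ ℂ i))

lemma contDiff_wt (lam : Fin n → ℝ) : ContDiff ℝ ∞ (wt lam) :=
  Complex.ofRealCLM.contDiff.comp (contDiff_phi0 lam).neg.exp

lemma fderiv_phi0 (lam : Fin n → ℝ) (z : Fin n → ℂ) (j : Fin n) (c : ℂ) :
    fderiv ℝ (phi0 lam) z (Pi.single j c) = lam j * (2 * inner ℝ (z j) c) := by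
  rw [(hasFDerivAt_phi0 lam z).fderiv]
  simp only [sum_apply]
  rw [Finset.sum_eq_single j]
  · simp; left; ring
  · intro b _ hb; simp [Pi.single_eq_of_ne hb]
  · simp

lemma fderiv_wt (lam : Fin n → ℝ) (z v : Fin n → ℂ) :
    fderiv ℝ (wt lam) z v = -(fderiv ℝ (phi0 lam) z v : ℝ) * wt lam z := by
  have h := ((contDiff_phi0 lam).differentiable (by simp) z).hasFDerivAt.neg.exp
  have h2 := (Complex.ofRealCLM.hasFDerivAt).comp z h
  have h3 : HasFDerivAt (wt lam) _ z := h2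
  rw [h3.fderiv]
  simp [wt]; ring

lemma wderiv_wt (lam : Fin n → ℝ) (j) (z : Fin n → ℂ) :
    wderiv j (wt lam) z = -((lam j : ℂ) * (starRingEnd ℂ) (z j)) * wt lam z := by
  simp only [wderiv, fderiv_wt, fderiv_phi0]
  have : (starRingEnd ℂ) (z j) = (z j).re - Complex.I * (z j).im := by
    apply Complex.ext <;> simp
  rw [this]
  simp [Complex.inner]
  ring

lemma wderivBar_wt (lam : Fin n → ℝ) (j) (z : Fin n → ℂ) :
    wderivBar j (wt lam) z = -((lam j : ℂ) * z j) * wt lam z := by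
  simp only [wderivBar, fderiv_wt, fderiv_phi0]
  have : z j = (z j).re + Complex.I * (z j).im := by
    apply Complex.ext <;> simp
  rw [this]
  simp [Complex.inner]
  ring

lemma contDiff_wderiv (j : Fin n) {u : (Fin n → ℂ) → ℂ} (hu : ContDiff ℝ ∞ u) :
    ContDiff ℝ ∞ (wderiv j u) := by
  have h : ContDiff ℝ ∞ (fderiv ℝ u) := hu.fderiv_right (by simp)
  unfold wderiv
  exact contDiff_const.mul ((h.clm_apply contDiff_const).sub
    (contDiff_const.mul (h.clm_apply contDiff_const)))

lemma contDiff_wderivBar (j : Fin n) {u : (Fin n → ℂ) → ℂ} (hu : ContDiff ℝ ∞ u) :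
    ContDiff ℝ ∞ (wderivBar j u) := by
  have h : ContDiff ℝ ∞ (fderiv ℝ u) := hu.fderiv_right (by simp)
  unfold wderivBar
  exact contDiff_const.mul ((h.clm_apply contDiff_const).add
    (contDiff_const.mul (h.clm_apply contDiff_const)))

lemma contDiff_conj {u : (Fin n → ℂ) → ℂ} (hu : ContDiff ℝ ∞ u) :
    ContDiff ℝ ∞ (fun z => (starRingEnd ℂ) (u z)) :=
  Complex.conjCLE.contDiff.comp hu

lemma contDiff_adjOp (lam : Fin n → ℝ) (j : Fin n) {u : (Fin n → ℂ) → ℂ} (hu : ContDiff ℝ ∞ u) :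
    ContDiff ℝ ∞ (adjOp lam j u) := by
  unfold adjOp
  exact (contDiff_wderiv j hu).neg.add
    ((contDiff_const.mul (contDiff_conj (contDiff_apply ℝ ℂ j))).mul hu)

lemma integrable_fderiv_cs {F : (Fin n → ℂ) → ℂ} (hF : ContDiff ℝ ∞ F) (hc : HasCompactSupport F)
    (v : Fin n → ℂ) : Integrable (fun z => fderiv ℝ F z v) := by
  have h : ContDiff ℝ ∞ (fderiv ℝ F) := hF.fderiv_right (by simp)
  exact (h.clm_apply contDiff_const).continuous.integrable_of_hasCompactSupport
    (hc.fderiv_apply (𝕜 := ℝ) v)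

lemma integral_fderiv_cs {F : (Fin n → ℂ) → ℂ} (hF : ContDiff ℝ ∞ F) (hc : HasCompactSupport F)
    (v : Fin n → ℂ) : ∫ z, fderiv ℝ F z v = 0 := by
  have := integral_mul_fderiv_eq_neg_fderiv_mul_of_integrable (μ := volume) (𝕜 := ℂ) (f := fun _ : Fin n → ℂ => (1:ℂ))
    (g := F) (v := v) (by simp) (by simpa using integrable_fderiv_cs hF hc v)
    (by simpa using hF.continuous.integrable_of_hasCompactSupport hc)
    (fun x _ => differentiableAt_const _) (fun x _ => hF.differentiable (by simp) x)
  simpa using this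

lemma wderiv_int {F : (Fin n → ℂ) → ℂ} (hF : ContDiff ℝ ∞ F) (hc : HasCompactSupport F) (j) :
    Integrable (wderiv j F) ∧ ∫ z, wderiv j F z = 0 := by
  have h := integrable_fderiv_cs hF hc
  refine ⟨((h _).sub ((h _).const_mul _)).const_mul _, ?_⟩
  unfold wderiv
  rw [integral_const_mul, integral_sub (h _) ((h _).const_mul _), integral_const_mul,
    integral_fderiv_cs hF hc, integral_fderiv_cs hF hc]
  simp

lemma wderivBar_int {F : (Fin n → ℂ) → ℂ} (hF : ContDiff ℝ ∞ F) (hc : HasCompactSupport F) (j) :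
    Integrable (wderivBar j F) ∧ ∫ z, wderivBar j F z = 0 := by
  have h := integrable_fderiv_cs hF hc
  refine ⟨((h _).add ((h _).const_mul _)).const_mul _, ?_⟩
  unfold wderivBar
  rw [integral_const_mul, integral_add (h _) ((h _).const_mul _), integral_const_mul,
    integral_fderiv_cs hF hc, integral_fderiv_cs hF hc]
  simp

lemma identA (lam : Fin n → ℝ) (j) {p f a : (Fin n → ℂ) → ℂ} (hp : ContDiff ℝ ∞ p)
    (hf : ContDiff ℝ ∞ f) (ha : ContDiff ℝ ∞ a) (z) :
    wderivBar j (fun z => p z * ((starRingEnd ℂ (f z) * wt lam z) * a z)) z =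
      wderivBar j p z * starRingEnd ℂ (f z) * a z * wt lam z
      + p z * starRingEnd ℂ (f z) * wderivBar j a z * wt lam z
      - p z * starRingEnd ℂ (adjOp lam j f z) * a z * wt lam z := by
  have dp := hp.differentiable (by simp) z
  have df := hf.differentiable (by simp) z
  have da := ha.differentiable (by simp) z
  have dc := (contDiff_conj hf).differentiable (by simp) z
  have dw := (contDiff_wt lam).differentiable (by simp) z
  have d1 : DifferentiableAt ℝ (fun z => starRingEnd ℂ (f z) * wt lam z) z := dc.mul dw
  have d2 : DifferentiableAt ℝ (fun z => (starRingEnd ℂ (f z) * wt lam z) * a z) z := d1.mul da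
  rw [wderivBar_mul j p _ z dp d2, wderivBar_mul j _ a z d1 da,
    wderivBar_mul j _ _ z dc dw, wderivBar_conj j f z df, wderivBar_wt]
  simp [adjOp]
  ring

lemma identB (lam : Fin n → ℝ) (j) {p f a : (Fin n → ℂ) → ℂ} (hp : ContDiff ℝ ∞ p)
    (hf : ContDiff ℝ ∞ f) (ha : ContDiff ℝ ∞ a) (z) :
    wderiv j (fun z => p z * ((starRingEnd ℂ (f z) * wt lam z) * a z)) z =
      wderiv j p z * starRingEnd ℂ (f z) * a z * wt lam z
      - p z * starRingEnd ℂ (f z) * adjOp lam j a z * wt lam z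
      + p z * starRingEnd ℂ (wderivBar j f z) * a z * wt lam z := by
  have dp := hp.differentiable (by simp) z
  have df := hf.differentiable (by simp) z
  have da := ha.differentiable (by simp) z
  have dc := (contDiff_conj hf).differentiable (by simp) z
  have dw := (contDiff_wt lam).differentiable (by simp) z
  have d1 : DifferentiableAt ℝ (fun z => starRingEnd ℂ (f z) * wt lam z) z := dc.mul dw
  have d2 : DifferentiableAt ℝ (fun z => (starRingEnd ℂ (f z) * wt lam z) * a z) z := d1.mul da
  rw [wderiv_mul j p _ z dp d2, wderiv_mul j _ a z d1 da,
    wderiv_mul j _ _ z dc dw, wderiv_conj j f z df, wderiv_wt]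
  simp [adjOp]
  ring

lemma integrable_of_l2 (lam : Fin n → ℝ) {u : (Fin n → ℂ) → ℂ} (hu : ContDiff ℝ ∞ u)
    (h : l2normSq lam u < ⊤) : Integrable (fun z => ‖u z‖ ^ 2 * Real.exp (-(phi0 lam z))) := by
  refine ⟨(((hu.continuous.norm.pow 2).mul
    (contDiff_phi0 lam).continuous.neg.rexp)).aestronglyMeasurable, ?_⟩
  rw [hasFiniteIntegral_iff_norm]
  refine lt_of_le_of_lt (le_of_eq ?_) h
  unfold l2normSq
  refine lintegral_congr fun z => ?_
  rw [Real.norm_of_nonneg (by positivity), ENNReal.ofReal_mul (by positivity),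
    ENNReal.ofReal_pow (norm_nonneg _), ofReal_norm]
  rfl
open Filter Topology

lemma norm_wderiv_le {G : (Fin n → ℂ) → ℂ} {M : ℝ} {z} (h : ‖fderiv ℝ G z‖ ≤ M) (j) :
    ‖wderiv j G z‖ ≤ M ∧ ‖wderivBar j G z‖ ≤ M := by
  have h1 : ‖fderiv ℝ G z (Pi.single j 1)‖ ≤ M := by
    refine (ContinuousLinearMap.le_opNorm _ _).trans ?_
    simpa [Pi.norm_single] using h
  have h2 : ‖fderiv ℝ G z (Pi.single j Complex.I)‖ ≤ M := by
    refine (ContinuousLinearMap.le_opNorm _ _).trans ?_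
    simpa [Pi.norm_single] using h
  constructor
  · unfold wderiv
    rw [norm_mul]
    have := norm_sub_le (fderiv ℝ G z (Pi.single j 1))
      (Complex.I * fderiv ℝ G z (Pi.single j Complex.I))
    rw [norm_mul, Complex.norm_I, one_mul] at this
    norm_num
    linarith
  · unfold wderivBar
    rw [norm_mul]
    have := norm_add_le (fderiv ℝ G z (Pi.single j 1))
      (Complex.I * fderiv ℝ G z (Pi.single j Complex.I))
    rw [norm_mul, Complex.norm_I, one_mul] at this
    norm_num
    linarith

lemma exists_cutoff (n : ℕ) : ∃ (p : ℕ → (Fin n → ℂ) → ℂ) (M : ℝ), 0 ≤ M ∧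
    (∀ k, ContDiff ℝ ∞ (p k)) ∧ (∀ k, HasCompactSupport (p k)) ∧ (∀ k z, ‖p k z‖ ≤ 1) ∧
    (∀ z, Tendsto (fun k => p k z) atTop (𝓝 1)) ∧
    (∀ k j z, ‖wderiv j (p k) z‖ ≤ M ∧ ‖wderivBar j (p k) z‖ ≤ M) ∧
    (∀ j z, Tendsto (fun k => wderiv j (p k) z) atTop (𝓝 0) ∧
      Tendsto (fun k => wderivBar j (p k) z) atTop (𝓝 0)) := by
  let g : ContDiffBump (0 : Fin n → ℂ) := ⟨1, 2, by norm_num, by norm_num⟩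
  let G : (Fin n → ℂ) → ℂ := fun z => ((g z : ℝ) : ℂ)
  have hG : ContDiff ℝ ∞ G := Complex.ofRealCLM.contDiff.comp g.contDiff
  have hGc : HasCompactSupport G := g.hasCompactSupport.comp_left (g := fun x : ℝ => (x : ℂ)) (by simp)
  have hfd : Continuous (fderiv ℝ G) := hG.continuous_fderiv (by simp)
  obtain ⟨M, hM⟩ := (hGc.fderiv (𝕜 := ℝ)).exists_bound_of_continuous hfd
  have hM0 : 0 ≤ M := (norm_nonneg _).trans (hM 0)
  let e : ℕ → ℝ := fun k => 1 / ((k : ℝ) + 1)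
  have he0 : ∀ k, 0 < e k := fun k => by positivity
  have he1 : ∀ k, e k ≤ 1 := fun k => by
    refine (div_le_one (by positivity)).2 ?_
    simp
  have het : Tendsto e atTop (𝓝 0) := tendsto_one_div_add_atTop_nhds_zero_nat
  have hfp : ∀ k z, fderiv ℝ (fun z => G (e k • z)) z = e k • fderiv ℝ G (e k • z) :=
    fun k z => fderiv_comp_smul (f := G) (x := z) (e k)
  have hfn : ∀ k z, ‖fderiv ℝ (fun z => G (e k • z)) z‖ ≤ e k * M := fun k z => by
    rw [hfp, norm_smul, Real.norm_of_nonneg (he0 k).le]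
    exact mul_le_mul_of_nonneg_left (hM _) (he0 k).le
  have heM : Tendsto (fun k => e k * M) atTop (𝓝 0) := by simpa using het.mul_const M
  refine ⟨fun k z => G (e k • z), M, hM0, ?_, ?_, ?_, ?_, ?_, ?_⟩
  · intro k
    exact hG.comp (contDiff_const_smul (e k))
  · intro k
    exact hGc.comp_smul (he0 k).ne'
  · intro k z
    simp only [G, Complex.norm_real, Real.norm_of_nonneg g.nonneg]
    exact g.le_one
  · intro z
    have h : Tendsto (fun k => G (e k • z)) atTop (𝓝 (G ((0 : ℝ) • z))) :=
      (hG.continuous.tendsto _).comp (het.smul_const z)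
    have h1 : G ((0 : ℝ) • z) = 1 := by
      simp only [G, zero_smul]
      rw [g.one_of_mem_closedBall]
      · simp
      · simp [g.rIn_pos.le]
    rwa [h1] at h
  · intro k j z
    refine norm_wderiv_le ((hfn k z).trans ?_) j
    exact mul_le_of_le_one_left hM0 (he1 k)
  · intro j z
    exact ⟨squeeze_zero_norm (fun k => (norm_wderiv_le (hfn k z) j).1) heM,
      squeeze_zero_norm (fun k => (norm_wderiv_le (hfn k z) j).2) heM⟩

lemma key (lam : Fin n → ℝ) (I : Finset (Fin n)) {f p : (Fin n → ℂ) → ℂ} (hf : ContDiff ℝ ∞ f)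
    (hp : ContDiff ℝ ∞ p) (hc : HasCompactSupport p)
    (hharm : ∀ z : Fin n → ℂ,
      (∑ j ∈ I, wderivBar j (fun w => adjOp lam j f w) z) +
        (∑ j ∈ Iᶜ, adjOp lam j (fun w => wderivBar j f w) z) = 0) :
    ∫ z, ((∑ j ∈ I, (p z * starRingEnd ℂ (adjOp lam j f z) -
          wderivBar j p z * starRingEnd ℂ (f z)) * adjOp lam j f z * wt lam z) +
      (∑ j ∈ Iᶜ, (p z * starRingEnd ℂ (wderivBar j f z) +
          wderiv j p z * starRingEnd ℂ (f z)) * wderivBar j f z * wt lam z)) = 0 := by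
  have hA := fun j => contDiff_adjOp lam j hf
  have hB := fun j => contDiff_wderivBar j hf
  have hF : ∀ a, ContDiff ℝ ∞ a →
      ContDiff ℝ ∞ (fun z => p z * ((starRingEnd ℂ (f z) * wt lam z) * a z)) := fun a ha =>
    hp.mul (((contDiff_conj hf).mul (contDiff_wt lam)).mul ha)
  have hFc : ∀ a : (Fin n → ℂ) → ℂ,
      HasCompactSupport (fun z => p z * ((starRingEnd ℂ (f z) * wt lam z) * a z)) := fun a =>
    hc.mul_right
  have iA := fun j => wderivBar_int (hF _ (hA j)) (hFc (adjOp lam j f)) j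
  have iB := fun j => wderiv_int (hF _ (hB j)) (hFc (wderivBar j f)) j
  have : ∀ z, ((∑ j ∈ I, (p z * starRingEnd ℂ (adjOp lam j f z) -
          wderivBar j p z * starRingEnd ℂ (f z)) * adjOp lam j f z * wt lam z) +
      (∑ j ∈ Iᶜ, (p z * starRingEnd ℂ (wderivBar j f z) +
          wderiv j p z * starRingEnd ℂ (f z)) * wderivBar j f z * wt lam z)) =
      (∑ j ∈ Iᶜ, wderiv j (fun z => p z * ((starRingEnd ℂ (f z) * wt lam z) * wderivBar j f z)) z)
      - ∑ j ∈ I, wderivBar j (fun z => p z * ((starRingEnd ℂ (f z) * wt lam z) * adjOp lam j f z)) z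
      := by
    intro z
    have h := congrArg (fun t => p z * starRingEnd ℂ (f z) * wt lam z * t) (hharm z)
    simp only [mul_add, Finset.mul_sum, mul_zero] at h
    rw [Finset.sum_congr rfl fun j _ => identB lam j hp hf (hB j) z,
      Finset.sum_congr rfl fun j _ => identA lam j hp hf (hA j) z]
    rw [← sub_eq_zero, ← h, ← sub_eq_zero]
    rw [Finset.sum_add_distrib, Finset.sum_sub_distrib, Finset.sum_sub_distrib,
      Finset.sum_add_distrib]
    simp only [add_mul, sub_mul]
    rw [Finset.sum_add_distrib, Finset.sum_sub_distrib]
    have e1 : ∀ j, p z * starRingEnd ℂ (f z) * wt lam z * wderivBar j (fun w => adjOp lam j f w) z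
      = p z * starRingEnd ℂ (f z) * wderivBar j (adjOp lam j f) z * wt lam z := fun j => by ring
    have e2 : ∀ j, p z * starRingEnd ℂ (f z) * wt lam z * adjOp lam j (fun w => wderivBar j f w) z
      = p z * starRingEnd ℂ (f z) * adjOp lam j (wderivBar j f) z * wt lam z := fun j => by ring
    simp only [e1, e2] at h ⊢
    linear_combination (0 : ℂ) * h
  simp_rw [this]
  rw [integral_sub (integrable_finsetSum _ fun j _ => (iB j).1)
    (integrable_finsetSum _ fun j _ => (iA j).1),
    integral_finsetSum _ fun j _ => (iB j).1, integral_finsetSum _ fun j _ => (iA j).1]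
  simp [(iA _).2, (iB _).2]

lemma wt_norm (lam : Fin n → ℝ) (z) : ‖wt lam z‖ = Real.exp (-(phi0 lam z)) := by
  simp only [wt, Complex.norm_real, Real.norm_of_nonneg (Real.exp_nonneg _)]

lemma term_bound {M : ℝ} (hM : 0 ≤ M) {p d f a w : ℂ} (hp : ‖p‖ ≤ 1) (hd : ‖d‖ ≤ M) :
    ‖(p * starRingEnd ℂ a + d * starRingEnd ℂ f) * a * w‖ ≤
      (1 + M) * (‖a‖ ^ 2 * ‖w‖) + M * (‖f‖ ^ 2 * ‖w‖) := by
  rw [norm_mul, norm_mul]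
  have h1 : ‖p * starRingEnd ℂ a + d * starRingEnd ℂ f‖ ≤ ‖a‖ + M * ‖f‖ := by
    refine (norm_add_le _ _).trans ?_
    rw [norm_mul, norm_mul, RCLike.norm_conj, RCLike.norm_conj]
    gcongr
    exact mul_le_of_le_one_left (norm_nonneg _) hp
  have h2 : (‖a‖ + M * ‖f‖) * ‖a‖ ≤ (1 + M) * ‖a‖ ^ 2 + M * ‖f‖ ^ 2 := by
    have : ‖f‖ * ‖a‖ ≤ ‖a‖ ^ 2 + ‖f‖ ^ 2 := by nlinarith [sq_nonneg (‖a‖ - ‖f‖), sq_nonneg ‖a‖, sq_nonneg ‖f‖]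
    nlinarith [mul_le_mul_of_nonneg_left this hM]
  calc _ ≤ (‖a‖ + M * ‖f‖) * ‖a‖ * ‖w‖ := by gcongr
    _ ≤ ((1 + M) * ‖a‖ ^ 2 + M * ‖f‖ ^ 2) * ‖w‖ := by gcongr
    _ = _ := by ring
end

/-- If `f` is smooth, `L²` against `e^{−φ₀}` together with the relevant first
derivatives, and satisfies `(∑_{j∈I} ∂/∂z̄_j ∘ ∂_j^* + ∑_{j∉I} ∂_j^* ∘ ∂/∂z̄_j) f = 0`,
then `∂_j^* f = 0` for `j ∈ I` and `∂f/∂z̄_j = 0` for `j ∉ I`. -/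
theorem model_laplace_component_system (n : ℕ) (lam : Fin n → ℝ) (I : Finset (Fin n))
    (f : (Fin n → ℂ) → ℂ) (hf : ContDiff ℝ (⊤ : ℕ∞) f)
    (hL2 : l2normSq lam f < ⊤)
    (hL2bar : ∀ j ∉ I, l2normSq lam (fun z => wderivBar j f z) < ⊤)
    (hL2adj : ∀ j ∈ I, l2normSq lam (fun z => adjOp lam j f z) < ⊤)
    (hharm : ∀ z : Fin n → ℂ,
      (∑ j ∈ I, wderivBar j (fun w => adjOp lam j f w) z) +
        (∑ j ∈ Iᶜ, adjOp lam j (fun w => wderivBar j f w) z) = 0) :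
    (∀ j ∈ I, ∀ z : Fin n → ℂ, adjOp lam j f z = 0) ∧
      (∀ j ∉ I, ∀ z : Fin n → ℂ, wderivBar j f z = 0) := by
  classical
  have hA := fun j => contDiff_adjOp lam j hf
  have hB := fun j => contDiff_wderivBar j hf
  obtain ⟨p, M, hM, hp, hpc, hp1, hpt, hpd, hpdt⟩ := exists_cutoff n
  let H : ℕ → (Fin n → ℂ) → ℂ := fun k z =>
    ((∑ j ∈ I, (p k z * starRingEnd ℂ (adjOp lam j f z) -
          wderivBar j (p k) z * starRingEnd ℂ (f z)) * adjOp lam j f z * wt lam z) +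
      (∑ j ∈ Iᶜ, (p k z * starRingEnd ℂ (wderivBar j f z) +
          wderiv j (p k) z * starRingEnd ℂ (f z)) * wderivBar j f z * wt lam z))
  let S : (Fin n → ℂ) → ℝ := fun z =>
    (∑ j ∈ I, ‖adjOp lam j f z‖ ^ 2 * Real.exp (-(phi0 lam z))) +
      (∑ j ∈ Iᶜ, ‖wderivBar j f z‖ ^ 2 * Real.exp (-(phi0 lam z)))
  let B : (Fin n → ℂ) → ℝ := fun z =>
    (∑ j ∈ I, ((1 + M) * (‖adjOp lam j f z‖ ^ 2 * Real.exp (-(phi0 lam z))) +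
        M * (‖f z‖ ^ 2 * Real.exp (-(phi0 lam z))))) +
      (∑ j ∈ Iᶜ, ((1 + M) * (‖wderivBar j f z‖ ^ 2 * Real.exp (-(phi0 lam z))) +
        M * (‖f z‖ ^ 2 * Real.exp (-(phi0 lam z)))))
  have iF := integrable_of_l2 lam hf hL2
  have iA := fun j (hj : j ∈ I) => integrable_of_l2 lam (hA j) (hL2adj j hj)
  have iB := fun j (hj : j ∈ Iᶜ) => integrable_of_l2 lam (hB j)
    (hL2bar j (Finset.mem_compl.1 hj))
  have hSi : MeasureTheory.Integrable S :=
    (MeasureTheory.integrable_finsetSum _ iA).add (MeasureTheory.integrable_finsetSum _ iB)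
  have hBi : MeasureTheory.Integrable B :=
    (MeasureTheory.integrable_finsetSum _ fun j hj =>
      ((iA j hj).const_mul _).add (iF.const_mul _)).add
    (MeasureTheory.integrable_finsetSum _ fun j hj =>
      ((iB j hj).const_mul _).add (iF.const_mul _))
  have hcw : Continuous (wt lam) := (contDiff_wt lam).continuous
  have hcf : Continuous f := hf.continuous
  have hcA := fun j => (hA j).continuous
  have hcB := fun j => (hB j).continuous
  have hHc : ∀ k, Continuous (H k) := by
    intro k
    have h1 := (hp k).continuous
    have h2 := fun j => (contDiff_wderiv j (hp k)).continuous
    have h3 := fun j => (contDiff_wderivBar j (hp k)).continuous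
    have cc := Complex.continuous_conj
    refine (continuous_finsetSum _ fun j _ => ?_).add (continuous_finsetSum _ fun j _ => ?_)
    · exact (((h1.mul (cc.comp (hcA j))).sub ((h3 j).mul (cc.comp hcf))).mul (hcA j)).mul hcw
    · exact (((h1.mul (cc.comp (hcB j))).add ((h2 j).mul (cc.comp hcf))).mul (hcB j)).mul hcw
  have hHB : ∀ k z, ‖H k z‖ ≤ B z := by
    intro k z
    refine (norm_add_le _ _).trans (add_le_add ?_ ?_)
    · refine norm_sum_le_of_le _ fun j _ => ?_
      rw [← wt_norm lam z, sub_eq_add_neg, ← neg_mul]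
      exact term_bound hM (hp1 k z) (by simpa using (hpd k j z).2)
    · refine norm_sum_le_of_le _ fun j _ => ?_
      rw [← wt_norm lam z]
      exact term_bound hM (hp1 k z) (hpd k j z).1
  have hlim : ∀ z, Filter.Tendsto (fun k => H k z) Filter.atTop (nhds ((S z : ℝ) : ℂ)) := by
    intro z
    have : ((S z : ℝ) : ℂ) =
        ((∑ j ∈ I, (1 * starRingEnd ℂ (adjOp lam j f z) -
          0 * starRingEnd ℂ (f z)) * adjOp lam j f z * wt lam z) +
        (∑ j ∈ Iᶜ, (1 * starRingEnd ℂ (wderivBar j f z) +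
          0 * starRingEnd ℂ (f z)) * wderivBar j f z * wt lam z)) := by
      simp only [S, one_mul, zero_mul, sub_zero, add_zero, Complex.conj_mul', wt]
      push_cast
      rfl
    rw [this]
    refine (tendsto_finsetSum _ fun j _ => ?_).add (tendsto_finsetSum _ fun j _ => ?_)
    · exact ((((hpt z).mul_const _).sub (((hpdt j z).2).mul_const _)).mul_const _).mul_const _
    · exact ((((hpt z).mul_const _).add (((hpdt j z).1).mul_const _)).mul_const _).mul_const _
  have hDCT := MeasureTheory.tendsto_integral_of_dominated_convergence
    (μ := MeasureTheory.volume) B (fun k => (hHc k).aestronglyMeasurable) hBi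
    (fun k => Filter.Eventually.of_forall (hHB k)) (Filter.Eventually.of_forall hlim)
  have hH0 : ∀ k, ∫ z, H k z = 0 := fun k => key lam I hf (hp k) (hpc k) hharm
  simp only [hH0] at hDCT
  have hS0 := tendsto_nhds_unique hDCT tendsto_const_nhds
  rw [integral_complex_ofReal, Complex.ofReal_eq_zero] at hS0
  have hSnn : 0 ≤ S := fun z => by
    simp only [S, Pi.zero_apply]; positivity
  have hce : Continuous fun z => Real.exp (-(phi0 lam z)) :=
    (contDiff_phi0 lam).continuous.neg.rexp
  have hSc : Continuous S :=
    (continuous_finsetSum _ fun j _ => ((hcA j).norm.pow 2).mul hce).add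
      (continuous_finsetSum _ fun j _ => ((hcB j).norm.pow 2).mul hce)
  have hSz : S = 0 :=
    (hSc.ae_eq_iff_eq MeasureTheory.volume continuous_const).1
      ((MeasureTheory.integral_eq_zero_iff_of_nonneg hSnn hSi).1 hS0)
  have hz : ∀ z, (∀ j ∈ I, adjOp lam j f z = 0) ∧ ∀ j ∈ Iᶜ, wderivBar j f z = 0 := by
    intro z
    have h := congrFun hSz z
    simp only [S, Pi.zero_apply] at h
    rw [add_eq_zero_iff_of_nonneg (by positivity) (by positivity),
      Finset.sum_eq_zero_iff_of_nonneg (fun _ _ => by positivity),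
      Finset.sum_eq_zero_iff_of_nonneg (fun _ _ => by positivity)] at h
    refine ⟨fun j hj => ?_, fun j hj => ?_⟩
    · simpa [(Real.exp_pos _).ne'] using h.1 j hj
    · simpa [(Real.exp_pos _).ne'] using h.2 j hj
  exact ⟨fun j hj z => (hz z).1 j hj, fun j hj z => (hz z).2 j (Finset.mem_compl.2 hj)⟩
end

section
/- Let n be a natural number, λ : Fin n → ℝ, and I ⊆ Fin n. Let f : ℂⁿ → ℂ be smooth, satisfy the model harmonicity equations for (I, λ), and satisfy ‖f‖²_{φ₀} < ∞. If there exists an index j such that either (j ∈ I and λ_j ≥ 0) or (j ∉ I and λ_j ≤ 0), then f(0) = 0. -/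
open scoped ENNReal NNReal

/-- `f` satisfies the model harmonicity equations for `(I, λ)`:
`∂_j^* f = 0` for `j ∈ I` and `∂f/∂z̄_j = 0` for `j ∉ I`. -/
def ModelHarmonic {n : ℕ} (lam : Fin n → ℝ) (I : Finset (Fin n))
    (f : (Fin n → ℂ) → ℂ) : Prop :=
  (∀ j ∈ I, ∀ z : Fin n → ℂ, adjOp lam j f z = 0) ∧
    (∀ j ∉ I, ∀ z : Fin n → ℂ, wderivBar j f z = 0)

open MeasureTheory Set

/-- An entire function with integrable absolute value vanishes at the origin. -/
lemma entire_L1_zero (F : ℂ → ℂ) (hF : Differentiable ℂ F)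
    (hi : ∫⁻ z, ‖F z‖ₑ < ⊤) : F 0 = 0 := by
  by_contra hne
  have hmv : ∀ r : ℝ, ENNReal.ofReal (2 * Real.pi) * ‖F 0‖ₑ ≤
      ∫⁻ θ in Ioo (-Real.pi) Real.pi, ‖F (Complex.polarCoord.symm (r, θ))‖ₑ := by
    intro r
    have h1 : Real.circleAverage F 0 r = F 0 := hF.diffContOnCl.circleAverage
    rw [Real.circleAverage_eq_integral_add (-Real.pi)] at h1
    rw [intervalIntegral.integral_comp_add_right (fun θ => F (circleMap 0 r θ))] at h1
    have e1 : (0:ℝ) + -Real.pi = -Real.pi := by ring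
    have e2 : 2 * Real.pi + -Real.pi = Real.pi := by ring
    rw [e1, e2] at h1
    have hpi := Real.pi_pos
    have h2 : (2 * Real.pi) • F 0 = ∫ θ in (-Real.pi)..Real.pi, F (circleMap 0 r θ) := by
      rw [← h1, smul_smul, mul_inv_cancel₀ (by positivity), one_smul]
    have h3 : ENNReal.ofReal (2 * Real.pi) * ‖F 0‖ₑ = ‖(2 * Real.pi) • F 0‖ₑ := by
      rw [enorm_smul, Real.enorm_eq_ofReal (by positivity)]
    rw [h3, h2, intervalIntegral.integral_of_le (by linarith), integral_Ioc_eq_integral_Ioo]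
    refine (enorm_integral_le_lintegral_enorm _).trans (le_of_eq ?_)
    congr 1
    ext θ
    rw [Complex.polarCoord_symm_apply, circleMap_zero, Complex.exp_mul_I]
    simp
  have hpolar := Complex.lintegral_comp_polarCoord_symm (fun z => ‖F z‖ₑ)
  have hFc := hF.continuous
  have hmeas : Measurable (fun p : ℝ × ℝ =>
      ENNReal.ofReal p.1 • ‖F (Complex.polarCoord.symm p)‖ₑ) := by
    have : Continuous (fun p : ℝ × ℝ => F (Complex.polarCoord.symm p)) := by
      simp only [Complex.polarCoord_symm_apply]
      fun_prop
    have h2 := this.measurable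
    simp only [smul_eq_mul]
    exact (ENNReal.measurable_ofReal.comp measurable_fst).mul h2.enorm
  rw [polarCoord_target, Measure.volume_eq_prod, ← Measure.prod_restrict,
    lintegral_prod _ hmeas.aemeasurable] at hpolar
  rw [← hpolar] at hi
  have hlow : ∫⁻ r in Ioi (1:ℝ), ENNReal.ofReal (2 * Real.pi) * ‖F 0‖ₑ ≤
      ∫⁻ r in Ioi (0:ℝ), ∫⁻ θ in Ioo (-Real.pi) Real.pi,
        ENNReal.ofReal r • ‖F (Complex.polarCoord.symm (r, θ))‖ₑ := by
    refine le_trans ?_ (lintegral_mono_set (Ioi_subset_Ioi zero_le_one))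
    refine setLIntegral_mono' measurableSet_Ioi fun r hr => ?_
    refine (hmv r).trans (lintegral_mono fun θ => ?_)
    have : (1 : ℝ≥0∞) ≤ ENNReal.ofReal r := by
      rw [← ENNReal.ofReal_one]; exact ENNReal.ofReal_le_ofReal (le_of_lt hr)
    simpa using mul_le_mul_left this ‖F (Complex.polarCoord.symm (r, θ))‖ₑ
  have := hlow.trans_lt hi
  rw [setLIntegral_const, Real.volume_Ioi, ENNReal.mul_top] at this
  · exact lt_irrefl _ this
  · have hpi := Real.pi_pos
    simp [hne, hpi]

lemma entire_L2_zero (H : ℂ → ℂ) (hH : Differentiable ℂ H)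
    (hi : ∫⁻ z, ‖H z‖ₑ ^ 2 < ⊤) (c : ℂ) : H c = 0 := by
  have := entire_L1_zero (fun z => H (z + c) ^ 2) (by fun_prop) (by
    simp only [enorm_pow]
    rw [lintegral_add_right_eq_self (fun z => ‖H z‖ₑ ^ 2) c]
    exact hi)
  simpa using this

lemma slice_hasFDerivAt {n : ℕ} (f : (Fin n → ℂ) → ℂ) (hf : Differentiable ℝ f)
    (j : Fin n) (a : Fin n → ℂ) (w : ℂ) :
    HasFDerivAt (fun w : ℂ => f (a + Pi.single j w))
      ((fderiv ℝ f (a + Pi.single j w)).comp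
        (ContinuousLinearMap.single ℝ (fun _ : Fin n => ℂ) j)) w := by
  have h1 : HasFDerivAt (fun w : ℂ => a + Pi.single j w)
      (ContinuousLinearMap.single ℝ (fun _ : Fin n => ℂ) j) w :=
    ((ContinuousLinearMap.single ℝ (fun _ : Fin n => ℂ) j).hasFDerivAt).const_add a
  exact HasFDerivAt.comp w (hf _).hasFDerivAt h1

lemma slice_holo {n : ℕ} (f : (Fin n → ℂ) → ℂ) (hf : Differentiable ℝ f)
    (j : Fin n) (a : Fin n → ℂ) (h : ∀ z, wderivBar j f z = 0) :
    Differentiable ℂ (fun w : ℂ => f (a + Pi.single j w)) := by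
  intro w
  have hd := slice_hasFDerivAt f hf j a w
  rw [differentiableAt_complex_iff_differentiableAt_real]
  refine ⟨hd.differentiableAt, ?_⟩
  rw [hd.fderiv]
  have := h (a + Pi.single j w)
  simp only [wderivBar] at this
  simp only [ContinuousLinearMap.comp_apply, ContinuousLinearMap.single_apply, smul_eq_mul]
  generalize fderiv ℝ f (a + Pi.single j w) (Pi.single j 1) = A at *
  generalize fderiv ℝ f (a + Pi.single j w) (Pi.single j Complex.I) = B at *
  linear_combination (-2 * Complex.I) * this + B * Complex.I_sq

lemma slice_antiholo {n : ℕ} (lam : Fin n → ℝ) (f : (Fin n → ℂ) → ℂ) (hf : Differentiable ℝ f)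
    (j : Fin n) (a : Fin n → ℂ) (ha : a j = 0) (h : ∀ z, adjOp lam j f z = 0) :
    Differentiable ℂ (fun w : ℂ => (starRingEnd ℂ) (f (a + Pi.single j w) *
      Complex.exp (-(lam j * (w * (starRingEnd ℂ) w))))) := by
  intro w
  have hd := slice_hasFDerivAt f hf j a w
  have hc : HasFDerivAt (fun w : ℂ => (starRingEnd ℂ) w)
    (Complex.conjCLE : ℂ →L[ℝ] ℂ) w := Complex.conjCLE.hasFDerivAt
  have he := ((((hasFDerivAt_id (𝕜 := ℝ) w).mul hc).const_mul (lam j : ℂ)).neg).cexp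
  have hm := hd.mul he
  have hcc := (Complex.conjCLE.hasFDerivAt (x := f (a + Pi.single j w) *
      Complex.exp (-(lam j * (w * (starRingEnd ℂ) w))))).comp w hm
  have hfin : HasFDerivAt (fun w : ℂ => (starRingEnd ℂ) (f (a + Pi.single j w) *
      Complex.exp (-(lam j * (w * (starRingEnd ℂ) w))))) _ w := hcc
  rw [differentiableAt_complex_iff_differentiableAt_real]
  refine ⟨hfin.differentiableAt, ?_⟩
  rw [hfin.fderiv]
  have := h (a + Pi.single j w)
  simp only [adjOp, wderiv, Pi.add_apply, Pi.single_eq_same, ha, zero_add] at this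
  have key : ∀ A B : ℂ, A = -Complex.I * B → (starRingEnd ℂ) A = Complex.I * (starRingEnd ℂ) B := by
    rintro A B rfl; simp
  simp only [ContinuousLinearMap.comp_apply, ContinuousLinearMap.single_apply, smul_eq_mul,
    ContinuousLinearEquiv.coe_coe, Complex.conjCLE_apply]
  apply key
  simp only [ContinuousLinearMap.add_apply, ContinuousLinearMap.smul_apply,
    ContinuousLinearMap.neg_apply, ContinuousLinearMap.comp_apply,
    ContinuousLinearMap.single_apply, smul_eq_mul, ContinuousLinearMap.id_apply, id,
    ContinuousLinearEquiv.coe_coe, Complex.conjCLE_apply, map_one, Complex.conj_I]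
  generalize fderiv ℝ f (a + Pi.single j w) (Pi.single j 1) = A at *
  generalize fderiv ℝ f (a + Pi.single j w) (Pi.single j Complex.I) = B at *
  generalize Complex.exp _ = E
  generalize f _ = g at *
  generalize (starRingEnd ℂ) w = v at *
  linear_combination (-2 * Complex.I * E) * this + E * B * Complex.I_sq

/-- If an `L²_{φ₀}` solution of the model harmonicity equations exists for an
index set `I` whose signature does not match the signs of `λ` in some direction
`j` (i.e. `j ∈ I` with `λ_j ≥ 0`, or `j ∉ I` with `λ_j ≤ 0`), then `f(0) = 0`. -/
theorem model_harmonic_vanishes_at_origin (n : ℕ) (lam : Fin n → ℝ) (I : Finset (Fin n))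
    (f : (Fin n → ℂ) → ℂ) (hf : ContDiff ℝ (⊤ : ℕ∞) f)
    (hharm : ModelHarmonic lam I f)
    (hL2 : l2normSq lam f < ⊤)
    (hj : ∃ j : Fin n, (j ∈ I ∧ 0 ≤ lam j) ∨ (j ∉ I ∧ lam j ≤ 0)) :
    f 0 = 0 := by
  obtain ⟨j, hj⟩ := hj
  have hfd : Differentiable ℝ f := hf.differentiable (by simp)
  have hfc := hf.continuous
  -- one-dimensional statement
  have slice : ∀ a : Fin n → ℂ, a j = 0 →
      ∫⁻ w : ℂ, (‖f (a + Pi.single j w)‖ₑ) ^ 2 *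
        ENNReal.ofReal (Real.exp (-(lam j * ‖w‖ ^ 2))) < ⊤ → f a = 0 := by
    intro a ha hi
    rcases hj with ⟨hjI, hl⟩ | ⟨hjI, hl⟩
    · have hD := slice_antiholo lam f hfd j a ha (hharm.1 j hjI)
      have := entire_L2_zero _ hD (lt_of_le_of_lt (lintegral_mono fun w => ?_) hi) 0
      · simpa using this
      · have e1 : Complex.exp (-(lam j * (w * (starRingEnd ℂ) w))) =
            ((Real.exp (-(lam j * ‖w‖ ^ 2)) : ℝ) : ℂ) := by
          rw [Complex.mul_conj, Complex.normSq_eq_norm_sq]; push_cast; rfl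
        have e2 : ∀ x : ℂ, ‖(starRingEnd ℂ) x‖ₑ = ‖x‖ₑ := fun x => by
          rw [← ofReal_norm_eq_enorm, ← ofReal_norm_eq_enorm, RCLike.norm_conj]
        rw [e2, e1, enorm_mul, mul_pow]
        gcongr
        have e3 : ‖((Real.exp (-(lam j * ‖w‖ ^ 2)) : ℝ) : ℂ)‖ₑ =
            ENNReal.ofReal (Real.exp (-(lam j * ‖w‖ ^ 2))) := by
          rw [← ofReal_norm_eq_enorm, Complex.norm_real, Real.norm_eq_abs, Real.abs_exp]
        rw [e3]
        apply pow_le_of_le_one (by simp) _ (by norm_num)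
        rw [ENNReal.ofReal_le_one, Real.exp_le_one_iff]
        have : 0 ≤ lam j * ‖w‖ ^ 2 := by positivity
        linarith
    · have hD := slice_holo f hfd j a (hharm.2 j hjI)
      have := entire_L2_zero _ hD (lt_of_le_of_lt (lintegral_mono fun w => ?_) hi) 0
      · simpa using this
      · apply le_mul_of_one_le_right (by simp)
        rw [ENNReal.one_le_ofReal, Real.one_le_exp_iff]
        nlinarith [sq_nonneg ‖w‖]
  clear hj hharm
  cases n with
  | zero => exact j.elim0
  | succ m =>
    have hmp := volume_preserving_piFinSuccAbove (fun _ : Fin (m+1) => ℂ) j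
    have hphic : Continuous (phi0 lam) := by unfold phi0; fun_prop
    have hmeas : Measurable (fun z : Fin (m+1) → ℂ =>
        (‖f z‖₊ : ℝ≥0∞) ^ 2 * ENNReal.ofReal (Real.exp (-(phi0 lam z)))) := by
      have := hfc.measurable
      have := hphic.measurable
      fun_prop
    unfold l2normSq at hL2
    have hmeas2 := hmeas.comp (MeasurableEquiv.measurable
      (MeasurableEquiv.piFinSuccAbove (fun _ : Fin (m+1) => ℂ) j).symm)
    have hFub := lintegral_prod_symm (μ := (volume : Measure ℂ))
      (ν := (volume : Measure (Fin m → ℂ))) _ hmeas2.aemeasurable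
    rw [← hmp.symm.lintegral_comp hmeas, Measure.volume_eq_prod] at hL2
    have hL3 := hFub.symm.trans_lt hL2
    have hae := ae_lt_top' (hmeas2.lintegral_prod_left').aemeasurable hL3.ne
    have hz : ∀ᵐ y : Fin m → ℂ, f (j.insertNth (α := fun _ => ℂ) 0 y) = 0 := by
      filter_upwards [hae] with y hy
      apply slice
      · simp
      · have hins : ∀ w : ℂ, (MeasurableEquiv.piFinSuccAbove (fun _ : Fin (m+1) => ℂ) j).symm (w, y)
            = j.insertNth (α := fun _ => ℂ) 0 y + Pi.single j w := by
          intro w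
          have : (MeasurableEquiv.piFinSuccAbove (fun _ : Fin (m+1) => ℂ) j).symm (w, y)
            = j.insertNth (α := fun _ => ℂ) w y := rfl
          rw [this]
          ext i
          refine Fin.succAboveCases j ?_ (fun k => ?_) i
          · simp
          · simp
        have hphi : ∀ w : ℂ, phi0 lam (j.insertNth (α := fun _ => ℂ) 0 y + Pi.single j w) =
            lam j * ‖w‖ ^ 2 + ∑ k, lam (j.succAbove k) * ‖y k‖ ^ 2 := by
          intro w
          simp [phi0, Fin.sum_univ_succAbove _ j]
        generalize ∑ k, lam (j.succAbove k) * ‖y k‖ ^ 2 = C at hphi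
        simp only [Function.comp_apply, hins, hphi] at hy
        have : ∀ w : ℂ, (‖f (j.insertNth (α := fun _ => ℂ) 0 y + Pi.single j w)‖₊ : ℝ≥0∞) ^ 2 *
            ENNReal.ofReal (Real.exp (-(lam j * ‖w‖ ^ 2 + C))) =
            (‖f (j.insertNth (α := fun _ => ℂ) 0 y + Pi.single j w)‖ₑ ^ 2 *
            ENNReal.ofReal (Real.exp (-(lam j * ‖w‖ ^ 2)))) * ENNReal.ofReal (Real.exp (-C)) := by
          intro w
          rw [neg_add, Real.exp_add, ENNReal.ofReal_mul (Real.exp_pos _).le, ← mul_assoc]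
          rfl
        simp only [this] at hy
        rw [lintegral_mul_const' _ _ ENNReal.ofReal_ne_top] at hy
        by_contra hcon
        rw [not_lt, top_le_iff] at hcon
        rw [hcon, ENNReal.top_mul (by simp [Real.exp_pos])] at hy
        exact lt_irrefl _ hy
    have hcont : Continuous (fun y : Fin m → ℂ => f (j.insertNth (α := fun _ => ℂ) 0 y)) :=
      hfc.comp (Continuous.finInsertNth j continuous_const continuous_id)
    have heq := (Continuous.ae_eq_iff_eq volume hcont (continuous_const (y := (0:ℂ)))).1 hz
    have := congrFun heq 0
    have h0 : (j.insertNth (α := fun _ => ℂ) 0 (0 : Fin m → ℂ)) = 0 := by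
      ext i
      refine Fin.succAboveCases j ?_ (fun k => ?_) i <;> simp
    simpa [h0] using this
end

section
/- Let n be a natural number and λ : Fin n → ℝ with λ_j ≠ 0 for all j, and let I = {j : λ_j < 0}. Then the supremum, over all smooth functions f : ℂⁿ → ℂ satisfying the model harmonicity equations for (I, λ), of |f(0)|² / ‖f‖²_{φ₀} (computed in the extended nonnegative reals [0,∞], with the conventions x/∞ = 0 and 0/0 = 0) equals (∏_j |λ_j|)/π^n. -/
open scoped ENNReal NNReal

open MeasureTheory

lemma lint_succ (n : ℕ) (F : (Fin (n+1) → ℂ) → ℝ≥0∞) (hF : Measurable F) :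
    ∫⁻ z, F z = ∫⁻ y : Fin n → ℂ, ∫⁻ w : ℂ, F (Fin.cons w y) := by
  have e := (volume_preserving_piFinSuccAbove (fun _ : Fin (n+1) => ℂ) 0).symm
  rw [← e.lintegral_comp hF, Measure.volume_eq_prod, lintegral_prod_symm]
  · simp [MeasurableEquiv.piFinSuccAbove, Fin.insertNthEquiv]
  · exact (hF.comp e.measurable).aemeasurable

lemma lint_prod (n : ℕ) (W : Fin n → ℂ → ℝ≥0∞) (hW : ∀ j, Measurable (W j)) :
    ∫⁻ z : Fin n → ℂ, ∏ j, W j (z j) = ∏ j, ∫⁻ w, W j w := by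
  induction n with
  | zero => simp [Measure.volume_pi_eq_dirac (0 : Fin 0 → ℂ)]
  | succ n ih =>
    rw [lint_succ _ _ (by fun_prop)]
    simp only [Fin.prod_univ_succ, Fin.cons_zero, Fin.cons_succ]
    rw [← ih _ (fun j => hW _), ← lintegral_const_mul _ (by fun_prop)]
    refine lintegral_congr fun y => ?_
    rw [lintegral_mul_const _ (hW 0)]

lemma submean (n : ℕ) (c : Fin n → ℝ≥0∞) (W : Fin n → ℂ → ℝ≥0∞) (hW : ∀ j, Measurable (W j))
    (u : (Fin n → ℂ) → ℝ≥0∞) (hu : Measurable u)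
    (h : ∀ j z, u (Function.update z j 0) * c j ≤ ∫⁻ w, u (Function.update z j w) * W j w) :
    u 0 * ∏ j, c j ≤ ∫⁻ z : Fin n → ℂ, u z * ∏ j, W j (z j) := by
  induction n with
  | zero => simp [Measure.volume_pi_eq_dirac (0 : Fin 0 → ℂ), lintegral_dirac]
  | succ n ih =>
    rw [lint_succ _ _ (by fun_prop)]
    simp only [Fin.prod_univ_succ, Fin.cons_zero, Fin.cons_succ]
    have hm : Measurable fun y : Fin n → ℂ => u (Fin.cons 0 y) := by
      refine hu.comp (measurable_pi_iff.2 fun i => ?_)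
      refine Fin.cases ?_ (fun i => ?_) i
      · simp
      · simp only [Fin.cons_succ]; fun_prop
    have key := ih (fun j => c j.succ) (fun j => W j.succ) (fun j => hW _)
      (fun y => u (Fin.cons 0 y)) hm (fun j z => by
        have := h j.succ (Fin.cons 0 z)
        simpa [← Fin.cons_update] using this)
    have h0 : (Fin.cons 0 (0 : Fin n → ℂ) : Fin (n+1) → ℂ) = 0 := by
      ext i; refine Fin.cases ?_ (fun i => ?_) i <;> simp
    rw [h0] at key
    calc u 0 * (c 0 * ∏ j : Fin n, c j.succ) = c 0 * (u 0 * ∏ j : Fin n, c j.succ) := by ring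
      _ ≤ c 0 * ∫⁻ z : Fin n → ℂ, u (Fin.cons 0 z) * ∏ j : Fin n, W j.succ (z j) := by gcongr
      _ = ∫⁻ z : Fin n → ℂ, c 0 * (u (Fin.cons 0 z) * ∏ j : Fin n, W j.succ (z j)) := by
          rw [lintegral_const_mul]; fun_prop
      _ ≤ _ := by
          refine lintegral_mono fun y => ?_
          have := h 0 (Fin.cons 0 y)
          simp only [Fin.update_cons_zero] at this
          have hm2 : Measurable fun w : ℂ => u (Fin.cons w y) := by
            refine hu.comp (measurable_pi_iff.2 fun i => ?_)
            refine Fin.cases ?_ (fun i => ?_) i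
            · simp only [Fin.cons_zero]; fun_prop
            · simp
          simp only [← mul_assoc]
          rw [lintegral_mul_const _ (show Measurable fun w => u (Fin.cons w y) * W 0 w from hm2.mul (hW 0))]
          gcongr
          rwa [mul_comm]

lemma gauss (a : ℝ) (ha : 0 < a) :
    ∫⁻ w : ℂ, ENNReal.ofReal (Real.exp (-(a * ‖w‖^2))) = ENNReal.ofReal (Real.pi / a) := by
  have h := GaussianFourier.integral_rexp_neg_mul_sq_norm (V := ℂ) ha
  simp only [Complex.finrank_real_complex] at h
  norm_num at h
  rw [← h, ofReal_integral_eq_lintegral_ofReal]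
  · by_contra hn
    rw [integral_undef hn] at h
    have : 0 < Real.pi / a := by positivity
    linarith
  · exact Filter.Eventually.of_forall fun _ => by positivity

lemma circ (H : ℂ → ℂ) (hH : Differentiable ℂ H) (w : ℂ) :
    ENNReal.ofReal (2 * Real.pi) * ‖H 0‖ₑ ^ 2 ≤
      ∫⁻ θ in Set.Ioc 0 (2 * Real.pi), ‖H (Circle.exp θ * w)‖ₑ ^ 2 := by
  have hd : Differentiable ℂ fun ζ : ℂ => H (ζ * w) ^ 2 := by fun_prop
  have h := (hd.diffContOnCl (s := Metric.ball 0 |1|)).circleAverage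
  rw [Real.circleAverage_def, intervalIntegral.integral_of_le Real.two_pi_pos.le] at h
  simp only [zero_mul] at h
  have h2 : (∫ θ in Set.Ioc 0 (2 * Real.pi), H (circleMap 0 1 θ * w) ^ 2)
      = (2 * Real.pi : ℝ) • H 0 ^ 2 := by
    rw [← h, smul_smul, mul_inv_cancel₀ (by positivity), one_smul]
  have h3 := enorm_integral_le_lintegral_enorm (μ := volume.restrict (Set.Ioc 0 (2 * Real.pi)))
    (fun θ => H (circleMap 0 1 θ * w) ^ 2)
  rw [h2, enorm_smul, enorm_pow, Real.enorm_of_nonneg (by positivity)] at h3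
  refine h3.trans (le_of_eq ?_)
  simp [circleMap, enorm_pow]

lemma holo (H : ℂ → ℂ) (hH : Differentiable ℂ H) (a : ℝ) (ha : 0 < a) :
    ‖H 0‖ₑ ^ 2 * ENNReal.ofReal (Real.pi / a) ≤
      ∫⁻ w : ℂ, ‖H w‖ₑ ^ 2 * ENNReal.ofReal (Real.exp (-(a * ‖w‖^2))) := by
  have hc := hH.continuous
  have hrot : ∀ θ : ℝ, ∫⁻ w : ℂ, ‖H w‖ₑ ^ 2 * ENNReal.ofReal (Real.exp (-(a * ‖w‖^2)))
      = ∫⁻ w : ℂ, ‖H (Circle.exp θ * w)‖ₑ ^ 2 * ENNReal.ofReal (Real.exp (-(a * ‖w‖^2))) := by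
    intro θ
    rw [← (rotation (Circle.exp θ)).measurePreserving.lintegral_comp (by fun_prop)]
    simp
  have hp : ENNReal.ofReal (2 * Real.pi) ≠ 0 := by
    simp [Real.pi_pos]
  refine (ENNReal.mul_le_mul_iff_right hp ENNReal.ofReal_ne_top).1 ?_
  calc _ = ∫⁻ w : ℂ, ENNReal.ofReal (2 * Real.pi) * ‖H 0‖ₑ ^ 2 *
        ENNReal.ofReal (Real.exp (-(a * ‖w‖^2))) := by
        rw [lintegral_const_mul _ (by fun_prop), gauss a ha, mul_assoc]
    _ ≤ ∫⁻ w : ℂ, ∫⁻ θ in Set.Ioc 0 (2 * Real.pi), ‖H (Circle.exp θ * w)‖ₑ ^ 2 *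
        ENNReal.ofReal (Real.exp (-(a * ‖w‖^2))) := by
        refine lintegral_mono fun w => ?_
        have hm : Measurable fun θ : ℝ => ‖H (Circle.exp θ * w)‖ₑ :=
          Continuous.measurable (continuous_enorm.comp (hc.comp (by fun_prop)))
        rw [lintegral_mul_const _ (hm.pow_const 2)]
        gcongr
        exact circ H hH w
    _ = ∫⁻ θ in Set.Ioc 0 (2 * Real.pi), ∫⁻ w : ℂ, ‖H (Circle.exp θ * w)‖ₑ ^ 2 *
        ENNReal.ofReal (Real.exp (-(a * ‖w‖^2))) := by
        rw [lintegral_lintegral_swap]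
        refine Measurable.aemeasurable ?_
        have hm : Measurable fun p : ℂ × ℝ => ‖H (Circle.exp p.2 * p.1)‖ₑ :=
          Continuous.measurable (continuous_enorm.comp (hc.comp (by fun_prop)))
        exact (hm.pow_const 2).mul (by fun_prop)
    _ = _ := by
        simp_rw [← hrot]
        simp [mul_comm]


lemma slice {n : ℕ} (f : (Fin n → ℂ) → ℂ) (hf : Differentiable ℝ f) (z : Fin n → ℂ) (j : Fin n)
    (w : ℂ) : DifferentiableAt ℝ (fun w => f (Function.update z j w)) w ∧
    ∀ e, fderiv ℝ (fun w => f (Function.update z j w)) w e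
      = fderiv ℝ f (Function.update z j w) (Pi.single j e) := by
  have h1 := (hf (Function.update z j w)).hasFDerivAt.comp w
    (hasFDerivAt_update (𝕜 := ℝ) z (i := j) w)
  refine ⟨h1.differentiableAt, fun e => ?_⟩
  have h2 := h1.fderiv
  rw [show (fun w => f (Function.update z j w)) = f ∘ Function.update z j from rfl, h2]
  simp only [ContinuousLinearMap.comp_apply]
  congr 1
  ext i
  by_cases hij : i = j
  · subst hij; simp
  · simp [hij]

lemma expDeriv (l : ℝ) (w : ℂ) :
    ∃ L : ℂ →L[ℝ] ℂ, HasFDerivAt (fun w : ℂ => ((Real.exp (l * ‖w‖ ^ 2) : ℝ) : ℂ)) L w ∧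
      L 1 = 2 * l * w.re * (Real.exp (l * ‖w‖ ^ 2) : ℝ) ∧
      L Complex.I = 2 * l * w.im * (Real.exp (l * ‖w‖ ^ 2) : ℝ) := by
  have h := Complex.ofRealCLM.hasFDerivAt.comp w
    (((hasStrictFDerivAt_norm_sq w).hasFDerivAt.const_mul l).exp)
  refine ⟨_, h, ?_, ?_⟩
  · simp [Complex.inner]; ring
  · simp [Complex.inner]; ring

lemma onevar_pos (v : ℂ → ℂ) (hv : Differentiable ℝ v) (l : ℝ) (hl : 0 < l)
    (h : ∀ w, fderiv ℝ v w 1 + Complex.I * fderiv ℝ v w Complex.I = 0) :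
    ‖v 0‖ₑ ^ 2 * ENNReal.ofReal (Real.pi / |l|) ≤
      ∫⁻ w : ℂ, ‖v w‖ₑ ^ 2 * ENNReal.ofReal (Real.exp (-(l * ‖w‖^2))) := by
  rw [abs_of_pos hl]
  refine holo v (fun w => ?_) l hl
  refine differentiableAt_complex_iff_differentiableAt_real.2 ⟨hv w, ?_⟩
  have h1 := h w
  rw [smul_eq_mul]
  linear_combination (-Complex.I) * h1 + (fderiv ℝ v w Complex.I) * Complex.I_mul_I

lemma onevar_neg (v : ℂ → ℂ) (hv : Differentiable ℝ v) (l : ℝ) (hl : l < 0)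
    (h : ∀ w, fderiv ℝ v w 1 - Complex.I * fderiv ℝ v w Complex.I
      = 2 * l * (starRingEnd ℂ) w * v w) :
    ‖v 0‖ₑ ^ 2 * ENNReal.ofReal (Real.pi / |l|) ≤
      ∫⁻ w : ℂ, ‖v w‖ₑ ^ 2 * ENNReal.ofReal (Real.exp (-(l * ‖w‖^2))) := by
  rw [abs_of_neg hl]
  set V : ℂ → ℂ := fun w => (starRingEnd ℂ) (v w) * ((Real.exp (-l * ‖w‖ ^ 2) : ℝ) : ℂ) with hV
  have hd : Differentiable ℂ V := by
    intro w
    obtain ⟨L, hL, hL1, hLI⟩ := expDeriv (-l) w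
    have hc : HasFDerivAt (fun w => (starRingEnd ℂ) (v w))
        ((Complex.conjCLE : ℂ →L[ℝ] ℂ).comp (fderiv ℝ v w)) w :=
      (Complex.conjCLE : ℂ →L[ℝ] ℂ).hasFDerivAt.comp w (hv w).hasFDerivAt
    have hm := hc.mul hL
    refine differentiableAt_complex_iff_differentiableAt_real.2 ⟨hm.differentiableAt, ?_⟩
    rw [show fderiv ℝ V w = _ from hm.fderiv]
    have h1 := congrArg (starRingEnd ℂ) (h w)
    simp only [map_sub, map_mul, Complex.conj_I, Complex.conj_conj, Complex.conj_ofReal,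
      map_ofNat] at h1
    have hw := Complex.re_add_im w
    simp only [ContinuousLinearMap.add_apply, ContinuousLinearMap.smul_apply,
      ContinuousLinearMap.comp_apply, hL1, hLI, smul_eq_mul, ContinuousLinearEquiv.coe_coe,
      Complex.conjCLE_apply]
    push_cast
    generalize Complex.exp _ = E
    generalize (starRingEnd ℂ) (fderiv ℝ v w 1) = A at *
    generalize (starRingEnd ℂ) (fderiv ℝ v w Complex.I) = B at *
    generalize (starRingEnd ℂ) (v w) = c at *
    linear_combination (-Complex.I * E) * h1 + 2 * l * c * Complex.I * E * hw + (B * E - 2 * l * c * E * w.im) * Complex.I_mul_I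
  have key := holo V hd (-l) (by linarith)
  have hV0 : ‖V 0‖ₑ = ‖v 0‖ₑ := by simp [hV, ← ofReal_norm]
  rw [hV0] at key
  refine key.trans (le_of_eq (lintegral_congr fun w => ?_))
  simp only [← ofReal_norm, hV]
  rw [← ENNReal.ofReal_pow (by positivity), ← ENNReal.ofReal_pow (by positivity),
    ← ENNReal.ofReal_mul (by positivity), ← ENNReal.ofReal_mul (by positivity)]
  congr 1
  rw [norm_mul, RCLike.norm_conj, Complex.norm_real, Real.norm_of_nonneg (by positivity), mul_pow,
    mul_assoc, sq (Real.exp _), ← Real.exp_add, ← Real.exp_add]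
  congr 2
  ring

lemma weight_prod {n : ℕ} (lam : Fin n → ℝ) (z : Fin n → ℂ) :
    ENNReal.ofReal (Real.exp (-(phi0 lam z)))
      = ∏ j, ENNReal.ofReal (Real.exp (-(lam j * ‖z j‖ ^ 2))) := by
  rw [← ENNReal.ofReal_prod_of_nonneg (fun _ _ => by positivity), ← Real.exp_sum, phi0,
    Finset.sum_neg_distrib]

lemma upper {n : ℕ} (lam : Fin n → ℝ) (hlam : ∀ j, lam j ≠ 0)
    (f : (Fin n → ℂ) → ℂ) (hf : ContDiff ℝ (⊤ : ℕ∞) f)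
    (hh : ModelHarmonic lam (Finset.univ.filter fun j => lam j < 0) f) :
    ‖f 0‖ₑ ^ 2 * ∏ j, ENNReal.ofReal (Real.pi / |lam j|) ≤ l2normSq lam f := by
  have hd : Differentiable ℝ f := hf.differentiable (by simp)
  have hm : Measurable fun z => ‖f z‖ₑ ^ 2 := hf.continuous.measurable.enorm.pow_const 2
  have := submean n (fun j => ENNReal.ofReal (Real.pi / |lam j|))
    (fun j w => ENNReal.ofReal (Real.exp (-(lam j * ‖w‖ ^ 2)))) (fun j => by fun_prop)
    (fun z => ‖f z‖ₑ ^ 2) hm (fun j z => by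
      have hs := slice f hd z j
      rcases lt_or_gt_of_ne (hlam j) with hl | hl
      · refine onevar_neg (fun w => f (Function.update z j w)) (fun w => (hs w).1) (lam j) hl ?_
        intro w
        have h1 := hh.1 j (by simpa using hl) (Function.update z j w)
        simp only [adjOp, wderiv, Function.update_self] at h1
        rw [(hs w).2, (hs w).2]
        linear_combination (-2) * h1
      · refine onevar_pos (fun w => f (Function.update z j w)) (fun w => (hs w).1) (lam j) hl ?_
        intro w
        have h1 := hh.2 j (by simpa using hl.le) (Function.update z j w)
        simp only [wderivBar] at h1
        rw [(hs w).2, (hs w).2]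
        linear_combination 2 * h1)
  refine this.trans (le_of_eq ?_)
  simp only [l2normSq, weight_prod]
  rfl

/-- The extremal function. -/
noncomputable def extremalFn {n : ℕ} (lam : Fin n → ℝ) (z : Fin n → ℂ) : ℂ :=
  ((Real.exp (∑ j, min (lam j) 0 * ‖z j‖ ^ 2) : ℝ) : ℂ)

lemma ext_smooth {n : ℕ} (lam : Fin n → ℝ) : ContDiff ℝ (⊤ : ℕ∞) (extremalFn lam) := by
  unfold extremalFn
  refine Complex.ofRealCLM.contDiff.comp (Real.contDiff_exp.comp ?_)
  refine ContDiff.sum fun j _ => contDiff_const.mul ?_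
  exact (contDiff_norm_sq ℝ).comp (contDiff_apply ℝ ℂ j)

lemma ext_deriv {n : ℕ} (lam : Fin n → ℝ) (z : Fin n → ℂ) (j : Fin n) :
    fderiv ℝ (extremalFn lam) z (Pi.single j 1)
      = 2 * (min (lam j) 0 : ℝ) * (z j).re * extremalFn lam z ∧
    fderiv ℝ (extremalFn lam) z (Pi.single j Complex.I)
      = 2 * (min (lam j) 0 : ℝ) * (z j).im * extremalFn lam z := by
  have hs := slice (extremalFn lam) ((ext_smooth lam).differentiable (by simp)) z j (z j)
  simp only [Function.update_eq_self] at hs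
  obtain ⟨L, hL, h1, hI⟩ := expDeriv (min (lam j) 0) (z j)
  set C : ℂ := ((Real.exp (∑ i ∈ Finset.univ.erase j, min (lam i) 0 * ‖z i‖ ^ 2) : ℝ) : ℂ) with hC
  have hfun : ∀ w, extremalFn lam (Function.update z j w)
      = C * ((Real.exp (min (lam j) 0 * ‖w‖ ^ 2) : ℝ) : ℂ) := by
    intro w
    rw [hC, extremalFn, ← Complex.ofReal_mul, ← Real.exp_add,
      ← Finset.sum_erase_add _ _ (Finset.mem_univ j)]
    congr 3
    · refine Finset.sum_congr rfl fun i hi => ?_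
      rw [Function.update_of_ne (Finset.ne_of_mem_erase hi)]
    · rw [Function.update_self]
  have hz := hfun (z j)
  rw [Function.update_eq_self] at hz
  have hD := (hL.const_mul C).fderiv
  rw [← hs.2, ← hs.2, funext hfun, hD, hz]
  simp only [ContinuousLinearMap.smul_apply, h1, hI, smul_eq_mul]
  constructor <;> ring

lemma ext_harm {n : ℕ} (lam : Fin n → ℝ) :
    ModelHarmonic lam (Finset.univ.filter fun j => lam j < 0) (extremalFn lam) := by
  constructor
  · intro j hj z
    have hl : lam j < 0 := by simpa using hj
    obtain ⟨h1, hI⟩ := ext_deriv lam z j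
    rw [min_eq_left hl.le] at h1 hI
    rw [adjOp, wderiv, h1, hI]
    have hw : (starRingEnd ℂ) (z j) = (z j).re - (z j).im * Complex.I := by
      apply Complex.ext <;> simp
    rw [hw]
    ring
  · intro j hj z
    have hl : 0 ≤ lam j := by simpa using hj
    obtain ⟨h1, hI⟩ := ext_deriv lam z j
    rw [min_eq_right hl] at h1 hI
    rw [wderivBar, h1, hI]
    simp

lemma ext_norm {n : ℕ} (lam : Fin n → ℝ) (hlam : ∀ j, lam j ≠ 0) :
    l2normSq lam (extremalFn lam) = ∏ j, ENNReal.ofReal (Real.pi / |lam j|) := by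
  have hg : ∀ j, ENNReal.ofReal (Real.pi / |lam j|)
      = ∫⁻ w : ℂ, ENNReal.ofReal (Real.exp (-(|lam j| * ‖w‖^2))) :=
    fun j => (gauss _ (abs_pos.2 (hlam j))).symm
  simp only [hg]
  rw [← lint_prod n _ (fun j => by fun_prop), l2normSq]
  refine lintegral_congr fun z => ?_
  rw [← ENNReal.ofReal_prod_of_nonneg (fun _ _ => by positivity), ← Real.exp_sum,
    ← enorm_eq_nnnorm, ← ofReal_norm, ← ENNReal.ofReal_pow (by positivity),
    ← ENNReal.ofReal_mul (by positivity), extremalFn, Complex.norm_real,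
    Real.norm_of_nonneg (by positivity), sq, ← Real.exp_add, ← Real.exp_add, phi0,
    ← Finset.sum_neg_distrib, ← Finset.sum_add_distrib, ← Finset.sum_add_distrib]
  congr 2
  refine Finset.sum_congr rfl fun j _ => ?_
  rcases le_total (lam j) 0 with hl | hl
  · rw [min_eq_left hl, abs_of_nonpos hl]; ring
  · rw [min_eq_right hl, abs_of_nonneg hl]; ring

lemma const_eq {n : ℕ} (lam : Fin n → ℝ) (hlam : ∀ j, lam j ≠ 0) :
    (∏ j : Fin n, ENNReal.ofReal |lam j|) / ENNReal.ofReal Real.pi ^ n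
      = (∏ j, ENNReal.ofReal (Real.pi / |lam j|))⁻¹ := by
  rw [← ENNReal.ofReal_prod_of_nonneg (fun _ _ => by positivity),
    ← ENNReal.ofReal_prod_of_nonneg (fun _ _ => by positivity),
    ← ENNReal.ofReal_pow Real.pi_pos.le, ← ENNReal.ofReal_div_of_pos (by positivity),
    ← ENNReal.ofReal_inv_of_pos
      (Finset.prod_pos fun j _ => div_pos Real.pi_pos (abs_pos.2 (hlam j)))]
  congr 1
  rw [Finset.prod_div_distrib, inv_div]
  simp

/-- The value of the model extremal function at the origin in the
matched-signature case: with all `λ_j ≠ 0` and `I = {j : λ_j < 0}`, the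
supremum over smooth solutions of the model harmonicity equations of
`|f(0)|²/‖f‖²_{φ₀}` (in `[0,∞]`) equals `(∏ j, |λ_j|)/π^n`. -/
theorem model_extremal_value (n : ℕ) (lam : Fin n → ℝ) (hlam : ∀ j, lam j ≠ 0)
    (I : Finset (Fin n)) (hI : I = Finset.univ.filter fun j => lam j < 0) :
    (⨆ (f : (Fin n → ℂ) → ℂ) (_ : ContDiff ℝ (⊤ : ℕ∞) f ∧ ModelHarmonic lam I f),
        (‖f 0‖₊ : ℝ≥0∞) ^ 2 / l2normSq lam f)
      = (∏ j : Fin n, ENNReal.ofReal |lam j|) / ENNReal.ofReal Real.pi ^ n := by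
  subst hI
  rw [const_eq lam hlam]
  set P := ∏ j, ENNReal.ofReal (Real.pi / |lam j|) with hP
  have hP0 : P ≠ 0 := Finset.prod_ne_zero_iff.2 fun j _ => by
    have := div_pos Real.pi_pos (abs_pos.2 (hlam j))
    simpa using this
  have hPt : P ≠ ⊤ := ENNReal.prod_ne_top fun j _ => ENNReal.ofReal_ne_top
  apply le_antisymm
  · refine iSup₂_le fun f hf => ENNReal.div_le_of_le_mul ?_
    have h := upper lam hlam f hf.1 hf.2
    rw [mul_comm, ← div_eq_mul_inv]
    exact (ENNReal.le_div_iff_mul_le (Or.inl hP0) (Or.inl hPt)).2 h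
  · refine le_trans (le_of_eq ?_)
      (le_iSup₂_of_le (extremalFn lam) ⟨ext_smooth lam, ext_harm lam⟩ le_rfl)
    rw [ext_norm lam hlam]
    simp [extremalFn, hP]
end
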